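/- Let G be a minimal counterexample. If H is an induced proper subgraph of G with ρ_G(H) < 3 and |V(H)| + |E(H)| ≤ 4, then H is one of the following five assigned graphs: a single vertex in I; two nonadjacent vertices both in I; a single edge with one endpoint in I and the other in U; a single edge with one endpoint in I and the other in F; or a single edge with one endpoint in I and the other in F together with one additional vertex in I that is adjacent to neither endpoint. -/

import Mathlib

open SimpleGraph

noncomputable def edgeCount {V : Type*} (G : SimpleGraph V) : ℕ := Nat.card G.edgeSet

noncomputable def deg {V : Type*} (G : SimpleGraph V) (v : V) : ℕ := Nat.card (G.neighborSet v)

def TwoIndependent {V : Type*} (G : SimpleGraph V) (S : Set V) : Prop :=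
  ∀ u ∈ S, ∀ v ∈ S, u ≠ v → ¬ G.Adj u v ∧ ∀ w, ¬ (G.Adj u w ∧ G.Adj w v)

def IsIFPartition {V : Type*} (G : SimpleGraph V) (A B : Set V) : Prop :=
  A ∪ B = Set.univ ∧ Disjoint A B ∧ TwoIndependent G A ∧ (G.induce B).IsAcyclic

def IsAssignment {V : Type*} (I F U : Set V) : Prop :=
  I ∪ F ∪ U = Set.univ ∧ Disjoint I F ∧ Disjoint I U ∧ Disjoint F U

noncomputable def rho {V : Type*} (G : SimpleGraph V) (I F U : Set V) (H : G.Subgraph) : ℤ :=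
  (H.verts ∩ I).ncard + 4 * (H.verts ∩ F).ncard + 5 * (H.verts ∩ U).ncard
    - 4 * Nat.card H.edgeSet

noncomputable def rhoSet {V : Type*} (G : SimpleGraph V) (I F U : Set V) (S : Set V) : ℤ :=
  (S ∩ I).ncard + 4 * (S ∩ F).ncard + 5 * (S ∩ U).ncard - 4 * edgeCount (G.induce S)

def IsCounterexample {V : Type*} [Fintype V] (G : SimpleGraph V) (I F U : Set V) : Prop :=
  IsAssignment I F U ∧
  (∀ H : G.Subgraph, H.verts.Nonempty → 0 < rho G I F U H) ∧
  ¬ ∃ A B : Set V, IsIFPartition G A B ∧ I ⊆ A ∧ F ⊆ B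

def IsMinCounterexample {V : Type*} [Fintype V] (G : SimpleGraph V) (I F U : Set V) : Prop :=
  IsCounterexample G I F U ∧
  ∀ (n : ℕ) (G' : SimpleGraph (Fin n)) (I' F' U' : Set (Fin n)),
    IsCounterexample G' I' F' U' →
    Fintype.card V + edgeCount G ≤ n + edgeCount G'

def IsThread {V : Type*} (G : SimpleGraph V) (I F U : Set V) (p : List V) : Prop :=
  p ≠ [] ∧ p.Nodup ∧ p.Chain' G.Adj ∧ (∀ v ∈ p, v ∈ U ∧ deg G v = 2) ∧
  (∀ w, w ∉ p → (∃ a ∈ p, G.Adj a w) → 3 ≤ deg G w ∨ w ∈ I ∪ F)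

def BordersThread {V : Type*} (G : SimpleGraph V) (p : List V) (w : V) : Prop :=
  w ∉ p ∧ ∃ a ∈ p, G.Adj a w

def IsStarForest {V : Type*} (H : SimpleGraph V) : Prop :=
  H.IsAcyclic ∧ ∀ a b c d : V, H.Adj a b → H.Adj b c → H.Adj c d → a = c ∨ b = d

def IsStarColoring {V : Type*} {k : ℕ} (G : SimpleGraph V) (c : V → Fin k) : Prop :=
  (∀ u v, G.Adj u v → c u ≠ c v) ∧
  ∀ i j : Fin k, IsStarForest (G.induce {v | c v = i ∨ c v = j})

def StarColorable {V : Type*} (G : SimpleGraph V) (k : ℕ) : Prop :=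
  ∃ c : V → Fin k, IsStarColoring G c

def MadLt {V : Type*} (G : SimpleGraph V) (q : ℚ) : Prop :=
  ∀ H : G.Subgraph, H.verts.Nonempty →
    (2 * (Nat.card H.edgeSet : ℚ)) / (H.verts.ncard : ℚ) < q

namespace IFP
open scoped Classical

/-- number of neighbours of `v` in `T` -/
noncomputable def d {V : Type*} (G : SimpleGraph V) (v : V) (T : Finset V) : ℕ :=
  (T.filter (G.Adj v)).card

/-- twice the number of edges inside `T` -/
noncomputable def s {V : Type*} (G : SimpleGraph V) (T : Finset V) : ℕ := ∑ v ∈ T, d G v T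

/-- number of edges between `A` and `B` -/
noncomputable def c {V : Type*} (G : SimpleGraph V) (A B : Finset V) : ℕ := ∑ v ∈ A, d G v B

/-- potential; label 2 means: in the forest without neighbours in the independent set,
4 means: in the forest, 5 means: unassigned -/
noncomputable def pot {V : Type*} (G : SimpleGraph V) (w : V → ℤ) (T : Finset V) : ℤ :=
  ∑ v ∈ T, w v - 2 * (s G T : ℤ)

def fr {V : Type*} (G : SimpleGraph V) (Y : Finset V) : Prop :=
  ∀ Z ⊆ Y, Z.Nonempty → s G Z < 2 * Z.card

structure Good {V : Type*} (G : SimpleGraph V) (w : V → ℤ) (X J : Finset V) : Prop where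
  sub : J ⊆ X
  lab : ∀ v ∈ J, w v = 5
  pin : ∀ p ∈ X, w p = 2 → ∀ v ∈ J, ¬ G.Adj p v
  ind : ∀ u ∈ J, ∀ v ∈ J, ¬ G.Adj u v
  ind2 : ∀ t ∈ X, ∀ u ∈ J, ∀ v ∈ J, G.Adj t u → G.Adj t v → u = v
  frst : fr G (X \ J)

def Ok {V : Type*} (G : SimpleGraph V) (w : V → ℤ) (X : Finset V) : Prop :=
  ∀ T ⊆ X, T.Nonempty → 1 ≤ pot G w T

def Lab {V : Type*} (w : V → ℤ) : Prop := ∀ v, w v = 2 ∨ w v = 4 ∨ w v = 5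

structure MinC {V : Type*} (G : SimpleGraph V) (w : V → ℤ) (X : Finset V) : Prop where
  lab : Lab w
  ok : Ok G w X
  bad : ¬ ∃ J, Good G w X J
  ih1 : ∀ (G' : SimpleGraph V) (w' : V → ℤ) (X' : Finset V), X'.card < X.card → Lab w' →
    Ok G' w' X' → ∃ J, Good G' w' X' J
  ih2 : ∀ (w' : V → ℤ), (X.filter (fun v => w' v = 5)).card < (X.filter (fun v => w v = 5)).card →
    Lab w' → Ok G w' X → ∃ J, Good G w' X J

variable {V : Type*} {G G' : SimpleGraph V} {w w' : V → ℤ} {X Y T A B : Finset V} {u v x y : V}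

lemma d_insert (h : u ∉ T) : d G v (insert u T) = d G v T + if G.Adj v u then 1 else 0 := by
  unfold d
  rw [Finset.filter_insert]
  split_ifs with h1
  · rw [Finset.card_insert_of_notMem]
    simp [h]
  · simp

lemma d_empty : d G v ∅ = 0 := by simp [d]

lemma s_empty : s G ∅ = 0 := by simp [s]

lemma d_sum : d G v T = ∑ u ∈ T, if G.Adj v u then 1 else 0 := by
  simp [d]

lemma s_insert (h : v ∉ T) : s G (insert v T) = s G T + 2 * d G v T := by
  unfold s
  rw [Finset.sum_insert h, d_insert h]
  simp only [SimpleGraph.irrefl, if_false]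
  have : ∀ u ∈ T, d G u (insert v T) = d G u T + if G.Adj v u then 1 else 0 := by
    intro u _
    rw [d_insert h]
    simp [G.adj_comm]
  rw [Finset.sum_congr rfl this, Finset.sum_add_distrib, ← d_sum]
  ring

lemma d_mono (h : A ⊆ B) : d G v A ≤ d G v B :=
  Finset.card_le_card (Finset.filter_subset_filter _ h)

lemma d_union (h : Disjoint A B) : d G v (A ∪ B) = d G v A + d G v B := by
  rw [d_sum, d_sum, d_sum, Finset.sum_union h]

lemma d_le (S : Finset V) (h : ∀ u ∈ T, G.Adj v u → u ∈ S) : d G v T ≤ S.card := by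
  apply Finset.card_le_card
  intro u hu
  simp only [Finset.mem_filter] at hu
  exact h u hu.1 hu.2

lemma d_ge (S : Finset V) (h : ∀ u ∈ S, u ∈ T ∧ G.Adj v u) : S.card ≤ d G v T := by
  apply Finset.card_le_card
  intro u hu
  simpa using h u hu

lemma d_graph (h : ∀ u ∈ T, G.Adj v u → G'.Adj v u) : d G v T ≤ d G' v T := by
  apply Finset.card_le_card
  intro u hu
  simp only [Finset.mem_filter] at hu ⊢
  exact ⟨hu.1, h u hu.1 hu.2⟩

lemma s_graph (h : ∀ u ∈ T, ∀ v ∈ T, G.Adj u v → G'.Adj u v) : s G T ≤ s G' T :=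
  Finset.sum_le_sum fun v hv => d_graph (h v hv)

lemma s_union (h : Disjoint A B) : s G (A ∪ B) = s G A + s G B + 2 * c G A B := by
  induction A using Finset.induction_on with
  | empty => simp [s_empty, c]
  | insert a A ha ih =>
    rw [Finset.disjoint_insert_left] at h
    rw [Finset.insert_union, s_insert (by simp [ha, h.1]), ih h.2, s_insert ha, d_union h.2]
    simp only [c, Finset.sum_insert ha]
    ring

lemma s_even : ∃ k, s G T = 2 * k := by
  induction T using Finset.induction_on with
  | empty => exact ⟨0, by simp [s_empty]⟩
  | insert a A ha ih =>
    obtain ⟨k, hk⟩ := ih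
    exact ⟨k + d G a A, by rw [s_insert ha, hk]; ring⟩

lemma pot_insert (h : v ∉ T) : pot G w (insert v T) = pot G w T + w v - 4 * (d G v T : ℤ) := by
  unfold pot
  rw [Finset.sum_insert h, s_insert h]
  push_cast
  ring

lemma pot_union (h : Disjoint A B) :
    pot G w (A ∪ B) = pot G w A + pot G w B - 4 * (c G A B : ℤ) := by
  unfold pot
  rw [Finset.sum_union h, s_union h]
  push_cast
  ring

lemma pot_single : pot G w {v} = w v := by
  simp [pot, s, d]

lemma c_comm : c G A B = c G B A := by
  unfold c
  simp only [d_sum]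
  rw [Finset.sum_comm]
  simp [G.adj_comm]

lemma fr_mono (h : A ⊆ B) (hB : fr G B) : fr G A := fun Z hZ => hB Z (hZ.trans h)

lemma fr_graph (h : ∀ u ∈ Y, ∀ v ∈ Y, G.Adj u v → G'.Adj u v) (hB : fr G' Y) : fr G Y :=
  fun Z hZ hn => (s_graph fun u hu v hv => h u (hZ hu) v (hZ hv)).trans_lt (hB Z hZ hn)

lemma fr_insert (hY : fr G Y) (h : d G v Y ≤ 1) : fr G (insert v Y) := by
  intro Z hZ hn
  by_cases hv : v ∈ Z
  · obtain ⟨Z0, hv0, rfl⟩ : ∃ Z0, v ∉ Z0 ∧ insert v Z0 = Z :=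
      ⟨Z.erase v, by simp, Finset.insert_erase hv⟩
    have hs : Z0 ⊆ Y := by
      intro z hz
      have := hZ (Finset.mem_insert_of_mem hz)
      rcases Finset.mem_insert.1 this with h | h
      · subst h; contradiction
      · exact h
    rw [s_insert hv0, Finset.card_insert_of_notMem hv0]
    have := (d_mono (G := G) (v := v) hs).trans h
    rcases Z0.eq_empty_or_nonempty with h0 | h0
    · subst h0; simp [s_empty, d_empty]
    · have := hY Z0 hs h0
      omega
  · exact hY Z ((Finset.subset_insert_iff_of_notMem hv).1 hZ) hn

lemma fr_insert' (v a : V) (hY : fr G Y) (h : ∀ u ∈ Y, G.Adj v u → u = a) :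
    fr G (insert v Y) :=
  fr_insert hY (d_le {a} (by simpa using h))

/-- replacing an edge `y b` by a path `y x b` keeps forests -/
lemma fr_subdiv {b : V} (hY : fr G' Y) (hle : ∀ u ∈ Y, ∀ v ∈ Y, G.Adj u v → G'.Adj u v)
    (h1 : G'.Adj y b) (h2 : ¬ G.Adj y b)
    (hx : ∀ u ∈ Y, G.Adj x u → u = y ∨ u = b) : fr G (insert x Y) := by
  intro Z hZ hn
  by_cases hv : x ∈ Z
  · obtain ⟨Z0, hv0, rfl⟩ : ∃ Z0, x ∉ Z0 ∧ insert x Z0 = Z :=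
      ⟨Z.erase x, by simp, Finset.insert_erase hv⟩
    have hs : Z0 ⊆ Y := by
      intro z hz
      have := hZ (Finset.mem_insert_of_mem hz)
      rcases Finset.mem_insert.1 this with h | h
      · subst h; contradiction
      · exact h
    by_cases hyb : y ∈ Z0 ∧ b ∈ Z0
    · have hd : d G x Z0 ≤ 2 := (d_le {y, b} (by
        intro u hu; simpa using hx u (hs hu))).trans Finset.card_le_two
      have h0 := hY Z0 hs ⟨y, hyb.1⟩
      rw [s_insert hv0, Finset.card_insert_of_notMem hv0]
      have : s G Z0 + 2 ≤ s G' Z0 := by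
        obtain ⟨Z1, hy1, rfl⟩ : ∃ Z1, y ∉ Z1 ∧ insert y Z1 = Z0 :=
          ⟨Z0.erase y, by simp, Finset.insert_erase hyb.1⟩
        rw [s_insert hy1, s_insert hy1]
        have e1 : s G Z1 ≤ s G' Z1 := s_graph fun u hu v hv =>
          hle u (hs (Finset.mem_insert_of_mem hu)) v (hs (Finset.mem_insert_of_mem hv))
        have e2 : d G y Z1 < d G' y Z1 := by
          apply Finset.card_lt_card
          rw [Finset.ssubset_iff_of_subset]
          · have : b ∈ Z1 := by
              rcases Finset.mem_insert.1 hyb.2 with h | h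
              · exact absurd h1 (by simp [h])
              · exact h
            exact ⟨b, by simp [this, h1], by simp [h2]⟩
          · intro u hu
            simp only [Finset.mem_filter] at hu ⊢
            exact ⟨hu.1, hle y (hs hyb.1) u (hs (Finset.mem_insert_of_mem hu.1)) hu.2⟩
        omega
      omega
    · have hd : d G x Z0 ≤ 1 := by
        by_cases hy : y ∈ Z0
        · apply d_le {y}
          intro u hu h
          rcases hx u (hs hu) h with h | h
          · simp [h]
          · subst h; tauto
        · apply d_le {b}
          intro u hu h
          rcases hx u (hs hu) h with h | h
          · subst h; tauto
          · simp [h]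
      have := fr_insert (fr_graph (fun u hu v hv => hle u (hs hu) v (hs hv)) (fr_mono hs hY)) hd
      exact this _ subset_rfl hn
  · have := (Finset.subset_insert_iff_of_notMem hv).1 hZ
    exact fr_graph hle hY Z this hn

lemma Good.of_le {J : Finset V} (h : Good G w' X J) (h5 : ∀ v ∈ X, w' v = 5 → w v = 5)
    (h2 : ∀ v ∈ X, w v = 2 → w' v = 2) : Good G w X J :=
  ⟨h.sub, fun v hv => h5 v (h.sub hv) (h.lab v hv), fun p hp hw => h.pin p hp (h2 p hp hw),
    h.ind, h.ind2, h.frst⟩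

lemma pot_le_relabel {k : ℤ} (hs : ∑ v ∈ T, w v - ∑ v ∈ T, w' v ≤ k) (hp : k + 1 ≤ pot G w T) :
    1 ≤ pot G w' T := by
  unfold pot at *
  linarith

/-- contraction of `S` to the vertex `p`, keeping only edges from `S \ J` -/
def contr (G : SimpleGraph V) (S J : Finset V) (p : V) : SimpleGraph V where
  Adj u v := (u ∉ S ∧ v ∉ S ∧ G.Adj u v) ∨
    (u = p ∧ v ∉ S ∧ v ≠ p ∧ ∃ t ∈ S \ J, G.Adj v t) ∨
    (v = p ∧ u ∉ S ∧ u ≠ p ∧ ∃ t ∈ S \ J, G.Adj u t)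
  symm := ⟨by
    rintro u v (h | h | h)
    · exact Or.inl ⟨h.2.1, h.1, h.2.2.symm⟩
    · exact Or.inr (Or.inr h)
    · exact Or.inr (Or.inl h)⟩
  loopless := ⟨by
    rintro u (h | h | h)
    · exact G.loopless.irrefl u h.2.2
    · exact h.2.2.1 h.1
    · exact h.2.2.1 h.1⟩

lemma sum_relabel_le (k : ℤ) (Q : V → Prop) [DecidablePred Q] (hq : ∀ v ∈ T, Q v → w v - w' v ≤ k)
    (hn : ∀ v ∈ T, ¬ Q v → w v - w' v ≤ 0) :
    ∑ v ∈ T, w v - ∑ v ∈ T, w' v ≤ k * ((T.filter Q).card : ℤ) := by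
  rw [← Finset.sum_sub_distrib, Finset.card_filter]
  push_cast
  rw [Finset.mul_sum]
  apply Finset.sum_le_sum
  intro v hv
  by_cases h : Q v
  · simpa [h] using hq v hv h
  · simpa [h] using hn v hv h

lemma card_filter_le_c (Q : V → Prop) [DecidablePred Q] (h : ∀ v ∈ T, Q v → ∃ u ∈ B, G.Adj v u) :
    (T.filter Q).card ≤ c G T B := by
  rw [Finset.card_filter]
  apply Finset.sum_le_sum
  intro v hv
  by_cases hQ : Q v
  · obtain ⟨u, hu, huv⟩ := h v hv hQ
    simp only [hQ, if_true]
    simpa using d_ge (G := G) (v := v) (T := B) {u} (by simp [hu, huv])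
  · simp [hQ]

lemma gap (M : MinC G w X) {S : Finset V} (hS : S ⊆ X) (hne : S ≠ X) (h2 : 2 ≤ S.card) :
    3 ≤ pot G w S := by
  by_contra hlt
  obtain ⟨S0, hS0⟩ : ∃ S0, S0 = S := ⟨S, rfl⟩
  rw [← hS0] at hS hne h2 hlt
  clear hS0
  obtain ⟨S, hSm, hmin⟩ := Finset.exists_min_image
    (X.powerset.filter fun S => S ≠ X ∧ 2 ≤ S.card) (pot G w) ⟨S0, by simp [hS, hne, h2]⟩
  have hlt : pot G w S ≤ 2 := by
    have := hmin S0 (by simp [hS, hne, h2])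
    omega
  clear hS hne h2
  simp only [Finset.mem_filter, Finset.mem_powerset, and_imp] at hSm hmin
  obtain ⟨hS, hne, h2⟩ := hSm
  have hSc : S.card < X.card := Finset.card_lt_card (Finset.ssubset_iff_subset_ne.2 ⟨hS, hne⟩)
  have hlb : ∀ v, 2 ≤ w v ∧ w v ≤ 5 := fun v => by rcases M.lab v with h | h | h <;> omega
  obtain ⟨p, hp⟩ : S.Nonempty := Finset.card_pos.1 (by omega)
  have hSok : Ok G w S := fun T hT => M.ok T (hT.trans hS)
  -- outside vertices have at most one neighbour in `S`
  have hd1 : ∀ v ∈ X, v ∉ S → d G v S ≤ 1 := by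
    intro v hv hvS
    have := M.ok (insert v S) (Finset.insert_subset hv hS) ⟨v, by simp⟩
    rw [pot_insert hvS] at this
    have := hlb v
    omega
  have huniq : ∀ v ∈ X, v ∉ S → ∀ a ∈ S, ∀ b ∈ S, G.Adj v a → G.Adj v b → a = b := by
    intro v hv hvS a ha b hb hva hvb
    have := hd1 v hv hvS
    exact Finset.card_le_one.1 this a (by simp [ha, hva]) b (by simp [hb, hvb])
  have hnoP : ∀ v ∈ X, v ∉ S → ∀ a ∈ S, G.Adj v a → w v ≠ 2 := by
    intro v hv hvS a ha hva hw
    have := M.ok (insert v S) (Finset.insert_subset hv hS) ⟨v, by simp⟩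
    rw [pot_insert hvS] at this
    have : 1 ≤ d G v S := by simpa using d_ge (G := G) (v := v) (T := S) {a} (by simp [ha, hva])
    omega
  -- the colouring of `S`
  obtain ⟨J, hJ, hJ'⟩ : ∃ J, Good G w S J ∧
      (pot G w S = 2 → c G (X \ S) S = 1 → ∀ v ∈ X \ S, ∀ j ∈ J, ¬ G.Adj v j) := by
    by_cases hc : pot G w S = 2 ∧ c G (X \ S) S = 1
    · let w1 : V → ℤ := fun v => if ∃ u ∈ X \ S, G.Adj v u then min (w v) 4 else w v
      obtain ⟨J, hJ⟩ := M.ih1 G w1 S hSc (by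
        intro v
        simp only [w1]
        rcases M.lab v with h | h | h <;> rw [h] <;> split_ifs <;> simp) (by
        intro T hT hTn
        have hsum := sum_relabel_le (w := w) (w' := w1) (T := T) 1
          (fun v => ∃ u ∈ X \ S, G.Adj v u) (by
            intro v _ h
            simp only [w1, if_pos h]
            have := hlb v
            omega) (by
            intro v _ h
            simp only [w1, if_neg h]
            omega)
        have hcc := card_filter_le_c (G := G) (T := T) (B := X \ S)
          (fun v => ∃ u ∈ X \ S, G.Adj v u) (by simp)
        have hcm : c G T (X \ S) ≤ c G S (X \ S) := Finset.sum_le_sum_of_subset hT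
        rw [c_comm (A := S), hc.2] at hcm
        by_cases h1 : T.card = 1
        · obtain ⟨v, rfl⟩ := Finset.card_eq_one.1 h1
          rw [pot_single]
          simp only [w1]
          have := hlb v
          split_ifs <;> omega
        · have : 2 ≤ T.card := by have := hTn.card_pos; omega
          have h3 := hmin T (hT.trans hS) (by
            rintro rfl
            exact hne (Finset.Subset.antisymm hS hT)) this
          apply pot_le_relabel (w := w) (k := 1)
          · linarith [(by exact_mod_cast hcc.trans hcm :
              (((T.filter (fun v => ∃ u ∈ X \ S, G.Adj v u)).card : ℕ) : ℤ) ≤ 1)]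
          · omega)
      refine ⟨J, hJ.of_le ?_ ?_, ?_⟩
      · intro v _ h
        simp only [w1] at h
        have := hlb v
        split_ifs at h
        · omega
        · exact h
      · intro v _ h
        simp only [w1, h]
        simp
      · intro _ _ v hv j hj hvj
        have := hJ.lab j hj
        simp only [w1, if_pos (⟨v, hv, hvj.symm⟩ : ∃ u ∈ X \ S, G.Adj j u)] at this
        omega
    · obtain ⟨J, hJ⟩ := M.ih1 G w S hSc M.lab hSok
      exact ⟨J, hJ, fun a b => absurd ⟨a, b⟩ hc⟩
  -- the reduced graph
  let Q : V → Prop := fun v => ∃ j ∈ J, G.Adj v j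
  let w' : V → ℤ := fun v => if v = p ∨ (v ∉ S ∧ Q v) then 2 else w v
  let G' := contr G S J p
  have hT' : ∀ T ⊆ X \ S, pot G w (T ∪ S) - pot G w S + 4 * (c G T S : ℤ)
      - 3 * ((T.filter Q).card : ℤ) ≤ pot G' w' T ∧ (T.filter Q).card + d G' p T ≤ c G T S ∧
      (T.filter Q = ∅ → pot G' w' T = pot G w T) := by
    intro T hT
    have hTS : ∀ v ∈ T, v ∈ X ∧ v ∉ S := fun v hv => by simpa using hT hv
    have hdis : Disjoint T S := Finset.disjoint_left.2 fun v hv => (hTS v hv).2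
    have hadj : ∀ u ∈ T, ∀ v ∈ T, (G'.Adj u v ↔ G.Adj u v) := by
      intro u hu v hv
      have h1 := (hTS u hu).2
      have h2 := (hTS v hv).2
      have h3 : u ≠ p := by rintro rfl; exact h1 hp
      have h4 : v ≠ p := by rintro rfl; exact h2 hp
      simp [G', contr, h1, h2, h3, h4]
    have hs : s G' T = s G T := le_antisymm
      (s_graph fun u hu v hv => (hadj u hu v hv).1) (s_graph fun u hu v hv => (hadj u hu v hv).2)
    have hnp : ∀ v ∈ T, v ≠ p := by
      rintro v hv rfl
      exact (hTS v hv).2 hp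
    refine ⟨?_, ?_, ?_⟩
    · rw [pot_union hdis]
      have := sum_relabel_le (w := w) (w' := w') (T := T) 3 Q (by
        intro v hv h
        have h0 := hlb v
        simp only [w', if_pos (Or.inr ⟨(hTS v hv).2, h⟩ : v = p ∨ (v ∉ S ∧ Q v))]
        omega) (by
        intro v hv h
        simp [w', h, hnp v hv])
      unfold pot at *
      rw [hs]
      linarith
    · unfold c
      have : d G' p T = ∑ v ∈ T, if (∃ t ∈ S \ J, G.Adj v t) then 1 else 0 := by
        rw [d_sum]
        apply Finset.sum_congr rfl
        intro v hv
        have : G'.Adj p v ↔ ∃ t ∈ S \ J, G.Adj v t := by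
          simp [G', contr, hp, (hTS v hv).2, hnp v hv]
        simp only [this]
      rw [this, Finset.card_filter, ← Finset.sum_add_distrib]
      apply Finset.sum_le_sum
      intro v hv
      have e : d G v S = d G v J + d G v (S \ J) := by
        rw [← d_union Finset.disjoint_sdiff, Finset.union_sdiff_of_subset hJ.sub]
      rw [e]
      apply add_le_add
      · split_ifs with h
        · obtain ⟨j, hj, hvj⟩ := h
          simpa using d_ge (G := G) (v := v) (T := J) {j} (by simp [hj, hvj])
        · simp
      · split_ifs with h
        · obtain ⟨j, hj, hvj⟩ := h
          simpa using d_ge (G := G) (v := v) (T := S \ J) {j} (by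
            intro u hu
            rw [Finset.mem_singleton] at hu
            subst hu
            exact ⟨hj, hvj⟩)
        · simp
    · intro hemp
      unfold pot
      rw [hs]
      congr 1
      apply Finset.sum_congr rfl
      intro v hv
      have : ¬ Q v := fun h => by
        have : v ∈ T.filter Q := by simp [hv, h]
        rw [hemp] at this
        simp at this
      simp [w', this, hnp v hv]
  have hunion : ∀ T ⊆ X \ S, T ∪ S ⊆ X := fun T hT =>
    Finset.union_subset (hT.trans Finset.sdiff_subset) hS
  obtain ⟨K, hK⟩ := M.ih1 G' w' (insert p (X \ S)) (by
      rw [Finset.card_insert_of_notMem (by simp [hp]), Finset.card_sdiff_of_subset hS]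
      omega) (by
      intro v
      simp only [w']
      split_ifs
      · simp
      · exact M.lab v) (by
      intro T hT hTn
      by_cases hpT : p ∈ T
      · obtain ⟨T0, hp0, rfl⟩ : ∃ T0, p ∉ T0 ∧ insert p T0 = T :=
          ⟨T.erase p, by simp, Finset.insert_erase hpT⟩
        have hT0 : T0 ⊆ X \ S := by
          intro z hz
          rcases Finset.mem_insert.1 (hT (Finset.mem_insert_of_mem hz)) with h | h
          · subst h; contradiction
          · exact h
        obtain ⟨e1, e2, -⟩ := hT' T0 hT0
        have e3 := M.ok (T0 ∪ S) (hunion T0 hT0) ⟨p, by simp [hp]⟩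
        rw [pot_insert hp0]
        have : w' p = 2 := by simp [w']
        omega
      · have hT0 : T ⊆ X \ S := (Finset.subset_insert_iff_of_notMem hpT).1 hT
        obtain ⟨e1, e2, e4⟩ := hT' T hT0
        have e3 := M.ok (T ∪ S) (hunion T hT0) ⟨p, by simp [hp]⟩
        rcases Finset.eq_empty_or_nonempty (T.filter Q) with h | h
        · rw [e4 h]
          exact M.ok T (hT0.trans Finset.sdiff_subset) hTn
        · have h1 := h.card_pos
          by_cases hX : T ∪ S = X
          · have hTX : X \ S = T := by
              rw [← hX, Finset.union_sdiff_cancel_right]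
              exact Finset.disjoint_left.2 fun v hv => by
                have := hT0 hv
                simp only [Finset.mem_sdiff] at this
                exact this.2
            by_contra hcon
            have q1 : c G T S = 1 := by omega
            have q2 : pot G w S = 2 := by omega
            have := hJ' q2 (hTX ▸ q1)
            obtain ⟨v, hv⟩ := h
            simp only [Finset.mem_filter] at hv
            obtain ⟨j, hj, hvj⟩ := hv.2
            exact this v (hTX ▸ hv.1) j hj hvj
          · have := hmin (T ∪ S) (hunion T hT0) hX
              (h2.trans (Finset.card_le_card Finset.subset_union_right))
            omega)
  -- lifting
  have hpK : p ∉ K := fun h => by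
    have := hK.lab p h
    simp [w'] at this
  have hKS : ∀ v ∈ K, v ∈ X ∧ v ∉ S := by
    intro v hv
    have := hK.sub hv
    simp only [Finset.mem_insert, Finset.mem_sdiff] at this
    rcases this with h | h
    · subst h; contradiction
    · exact h
  have hKno : ∀ v ∈ K, ∀ t ∈ S, ¬ G.Adj v t := by
    intro v hv t ht hvt
    obtain ⟨hvX, hvS⟩ := hKS v hv
    by_cases htJ : t ∈ J
    · have := hK.lab v hv
      have hQ : Q v := ⟨t, htJ, hvt⟩
      simp [w', hvS, hQ] at this
    · have : G'.Adj p v := Or.inr (Or.inl ⟨rfl, hvS, by rintro rfl; exact hpK hv, t,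
        by simp [ht, htJ], hvt⟩)
      exact hK.pin p (by simp) (by simp [w']) v hv this
  have hout : ∀ u v, u ∉ S → v ∉ S → G.Adj u v → G'.Adj u v := fun u v hu hv h =>
    Or.inl ⟨hu, hv, h⟩
  have hmemX : ∀ t ∈ X, t ∉ S → t ∈ insert p (X \ S) := fun t ht htS => by simp [ht, htS]
  have hQno : ∀ t ∈ X, t ∉ S → ∀ j ∈ J, G.Adj t j → ∀ v ∈ K, ¬ G.Adj t v := by
    intro t ht htS j hj htj v hv htv
    have hQ : Q t := ⟨j, hj, htj⟩
    exact hK.pin t (hmemX t ht htS) (by simp [w', htS, hQ]) v hv (hout t v htS (hKS v hv).2 htv)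
  apply M.bad
  refine ⟨J ∪ K, ?_, ?_, ?_, ?_, ?_, ?_⟩
  · exact Finset.union_subset (hJ.sub.trans hS) fun v hv => (hKS v hv).1
  · intro v hv
    rcases Finset.mem_union.1 hv with h | h
    · exact hJ.lab v h
    · have := hK.lab v h
      simp only [w'] at this
      split_ifs at this
      · omega
      · exact this
  · intro t ht hw v hv
    rcases Finset.mem_union.1 hv with h | h
    · by_cases htS : t ∈ S
      · exact hJ.pin t htS hw v h
      · exact fun hh => hnoP t ht htS v (hJ.sub h) hh hw
    · by_cases htS : t ∈ S
      · exact fun hh => hKno v h t htS hh.symm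
      · intro hh
        refine hK.pin t (hmemX t ht htS) ?_ v h (hout t v htS (hKS v h).2 hh)
        simp only [w', hw]
        simp
  · intro u hu v hv
    rcases Finset.mem_union.1 hu with hu | hu <;> rcases Finset.mem_union.1 hv with hv | hv
    · exact hJ.ind u hu v hv
    · exact fun h => hKno v hv u (hJ.sub hu) h.symm
    · exact hKno u hu v (hJ.sub hv)
    · exact fun h => hK.ind u hu v hv (hout u v (hKS u hu).2 (hKS v hv).2 h)
  · intro t ht u hu v hv htu htv
    by_cases htS : t ∈ S
    · rcases Finset.mem_union.1 hu with hu | hu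
      · rcases Finset.mem_union.1 hv with hv | hv
        · exact hJ.ind2 t htS u hu v hv htu htv
        · exact absurd htv.symm (hKno v hv t htS)
      · exact absurd htu.symm (hKno u hu t htS)
    · rcases Finset.mem_union.1 hu with hu | hu <;> rcases Finset.mem_union.1 hv with hv | hv
      · exact huniq t ht htS u (hJ.sub hu) v (hJ.sub hv) htu htv
      · exact absurd htv (hQno t ht htS u hu htu v hv)
      · exact absurd htu (hQno t ht htS v hv htv u hu)
      · exact hK.ind2 t (hmemX t ht htS) u hu v hv (hout t u htS (hKS u hu).2 htu)
          (hout t v htS (hKS v hv).2 htv)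
  · intro Z hZ hZn
    have hZ0 : ∀ v ∈ Z, v ∈ X ∧ v ∉ J ∧ v ∉ K := fun v hv => by simpa using hZ hv
    have hsplit : Z = (Z \ S) ∪ (Z ∩ S) := (Finset.sdiff_union_inter Z S).symm
    have hdis : Disjoint (Z \ S) (Z ∩ S) :=
      Finset.disjoint_left.2 fun v hv hv' => by simp at hv hv'; tauto
    have hsub1 : insert p (Z \ S) ⊆ insert p (X \ S) \ K := by
      intro v hv
      simp only [Finset.mem_insert, Finset.mem_sdiff] at hv ⊢
      rcases hv with rfl | hv
      · exact ⟨Or.inl rfl, hpK⟩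
      · exact ⟨Or.inr ⟨(hZ0 v hv.1).1, hv.2⟩, (hZ0 v hv.1).2.2⟩
    have hpZ : p ∉ Z \ S := by simp [hp]
    have hsG : s G (Z \ S) ≤ s G' (Z \ S) := s_graph fun u hu v hv => by
      simp only [Finset.mem_sdiff] at hu hv
      exact hout u v hu.2 hv.2
    have hcard : Z.card = (Z \ S).card + (Z ∩ S).card := by
      conv_lhs => rw [hsplit]
      exact Finset.card_union_of_disjoint hdis
    by_cases hne0 : (Z ∩ S).Nonempty
    · have f1 := hJ.frst (Z ∩ S) (by
        intro v hv
        simp only [Finset.mem_inter, Finset.mem_sdiff] at hv ⊢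
        exact ⟨hv.2, (hZ0 v hv.1).2.1⟩) hne0
      have f2 := hK.frst _ hsub1 ⟨p, by simp⟩
      rw [s_insert hpZ, Finset.card_insert_of_notMem hpZ] at f2
      have f3 : s G Z = s G (Z \ S) + s G (Z ∩ S) + 2 * c G (Z \ S) (Z ∩ S) := by
        conv_lhs => rw [hsplit]
        exact s_union hdis
      have f4 : c G (Z \ S) (Z ∩ S) ≤ d G' p (Z \ S) := by
        rw [d_sum]
        apply Finset.sum_le_sum
        intro v hv
        simp only [Finset.mem_sdiff] at hv
        have hv1 := hZ0 v hv.1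
        split_ifs with h
        · exact (d_mono Finset.inter_subset_right).trans (hd1 v hv1.1 hv.2)
        · rw [Nat.le_zero, d, Finset.card_eq_zero, Finset.filter_eq_empty_iff]
          intro t ht htv
          simp only [Finset.mem_inter] at ht
          exact h (Or.inr (Or.inl ⟨rfl, hv.2, by rintro rfl; exact hv.2 hp, t,
            by simp [ht.2, (hZ0 t ht.1).2.1], htv⟩))
      obtain ⟨k1, hk1⟩ := s_even (G := G) (T := Z ∩ S)
      omega
    · rw [Finset.not_nonempty_iff_eq_empty] at hne0
      have hZS : Z \ S = Z := by
        conv_rhs => rw [hsplit, hne0, Finset.union_empty]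
      have f2 := hK.frst (Z \ S) ((Finset.subset_insert _ _).trans hsub1) (by rwa [hZS])
      rw [hZS] at f2 hsG
      omega

lemma MinC.lb (M : MinC G w X) (v : V) : 2 ≤ w v ∧ w v ≤ 5 := by
  rcases M.lab v with h | h | h <;> omega

lemma gap2 (M : MinC G w X) (hS : T ⊆ X) (hne : T ≠ X) (hn : T.Nonempty) :
    2 ≤ pot G w T := by
  by_cases h1 : T.card = 1
  · obtain ⟨v, rfl⟩ := Finset.card_eq_one.1 h1
    rw [pot_single]
    exact (M.lb v).1
  · have := gap M hS hne (by have := hn.card_pos; omega)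
    omega

lemma ok_relabel (M : MinC G w X) (hY : Y ⊆ X) (hne : Y ≠ X) (hl : Lab w')
    (h : ∀ T ⊆ Y, ∑ v ∈ T, w v - ∑ v ∈ T, w' v ≤ 2) : Ok G w' Y := by
  intro T hT hn
  by_cases h1 : T.card = 1
  · obtain ⟨v, rfl⟩ := Finset.card_eq_one.1 h1
    rw [pot_single]
    rcases hl v with h | h | h <;> omega
  · have := gap M (hT.trans hY) (by
      rintro rfl
      exact hne (Finset.Subset.antisymm hY hT)) (by have := hn.card_pos; omega)
    exact pot_le_relabel (h T hT) this

lemma sum_update_le {a : V} {k m : ℤ} (h : w a - k ≤ m) (hm : 0 ≤ m) :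
    ∑ v ∈ T, w v - ∑ v ∈ T, Function.update w a k v ≤ m := by
  by_cases ha : a ∈ T
  · rw [Finset.sum_update_of_mem ha, ← Finset.sum_sdiff (Finset.singleton_subset_iff.2 ha)]
    simp
    linarith
  · rw [Finset.sum_update_of_notMem ha]
    simpa using hm

lemma lab_update (hl : Lab w) {a : V} {k : ℤ} (hk : k = 2 ∨ k = 4 ∨ k = 5) :
    Lab (Function.update w a k) := by
  intro v
  by_cases h : v = a
  · subst h; simpa using hk
  · simpa [h] using hl v

lemma pot_X (M : MinC G w X) : pot G w X = 1 := by
  by_contra hne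
  have hXn : X.Nonempty := by
    rw [Finset.nonempty_iff_ne_empty]
    rintro rfl
    apply M.bad
    refine ⟨∅, by simp, by simp, by simp, by simp, by simp, ?_⟩
    intro Z hZ hn
    simp at hZ
    subst hZ
    simp at hn
  have hge : 2 ≤ pot G w X := by
    have := M.ok X subset_rfl hXn
    omega
  by_cases hU : ∃ u ∈ X, w u = 5
  · obtain ⟨u, hu, hu5⟩ := hU
    obtain ⟨J, hJ⟩ := M.ih2 (Function.update w u 4) (by
      apply Finset.card_lt_card
      rw [Finset.ssubset_iff_of_subset]
      · exact ⟨u, by simp [hu, hu5], by simp⟩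
      · intro v hv
        simp only [Finset.mem_filter] at hv ⊢
        refine ⟨hv.1, ?_⟩
        by_cases h : v = u
        · subst h; exact hu5
        · simpa [h] using hv.2) (lab_update M.lab (by simp)) (by
      intro T hT hn
      have hd : ∑ v ∈ T, w v - ∑ v ∈ T, Function.update w u 4 v ≤ 1 :=
        sum_update_le (by omega) (by omega)
      apply pot_le_relabel hd
      by_cases h : T = X
      · subst h; omega
      · have := gap2 M hT h hn
        omega)
    refine M.bad ⟨J, hJ.of_le ?_ ?_⟩
    · intro v _ h
      by_cases hv : v = u
      · subst hv; exact hu5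
      · simpa [hv] using h
    · intro v _ h
      have : v ≠ u := by rintro rfl; omega
      simpa [this] using h
  · apply M.bad
    refine ⟨∅, by simp, by simp, by simp, by simp, by simp, ?_⟩
    intro Z hZ hn
    simp only [Finset.sdiff_empty] at hZ
    have h1 := M.ok Z hZ hn
    have h2 : ∑ v ∈ Z, w v ≤ ∑ v ∈ Z, 4 := by
      apply Finset.sum_le_sum
      intro v hv
      have : w v ≠ 5 := fun h => hU ⟨v, hZ hv, h⟩
      rcases M.lab v with h | h | h <;> omega
    simp only [Finset.sum_const, nsmul_eq_mul] at h2
    unfold pot at h1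
    omega

lemma d_erase_self : d G v (X.erase v) = d G v X := by
  unfold d
  congr 1
  ext u
  simp only [Finset.mem_filter, Finset.mem_erase]
  constructor
  · tauto
  · rintro ⟨h1, h2⟩
    exact ⟨⟨by rintro rfl; exact G.loopless.irrefl _ h2, h1⟩, h2⟩

lemma pot_erase (hv : v ∈ X) : pot G w X = pot G w (X.erase v) + w v - 4 * (d G v X : ℤ) := by
  conv_lhs => rw [← Finset.insert_erase hv]
  rw [pot_insert (by simp), d_erase_self]

lemma erase_ne (hv : v ∈ X) : X.erase v ≠ X := by
  intro h
  rw [← h] at hv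
  simp at hv

lemma low_deg (M : MinC G w X) (hv : v ∈ X) (hw : 4 ≤ w v) : 2 ≤ d G v X := by
  by_contra hlt
  have h1 := pot_erase (G := G) (w := w) hv
  rw [pot_X M] at h1
  by_cases hn : (X.erase v).Nonempty
  · have := gap2 M (Finset.erase_subset _ _) (erase_ne hv) hn
    omega
  · rw [Finset.not_nonempty_iff_eq_empty] at hn
    have h2 := pot_X M
    rw [← Finset.insert_erase hv, hn] at h2
    simp [pot_single] at h2
    omega

lemma pin_deg (M : MinC G w X) {p : V} (hp : p ∈ X) (hw : w p = 2) : 2 ≤ d G p X := by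
  by_contra hlt
  let w' : V → ℤ := fun v => if G.Adj p v then min (w v) 4 else w v
  obtain ⟨J, hJ⟩ := M.ih1 G w' (X.erase p) (Finset.card_erase_lt_of_mem hp) (by
      intro v
      simp only [w']
      rcases M.lab v with h | h | h <;> rw [h] <;> split_ifs <;> simp) (by
      apply ok_relabel M (Finset.erase_subset _ _) (erase_ne hp)
      · intro v
        simp only [w']
        rcases M.lab v with h | h | h <;> rw [h] <;> split_ifs <;> simp
      · intro T hT
        have h1 := sum_relabel_le (w := w) (w' := w') (T := T) 1 (G.Adj p) (by
          intro v _ h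
          simp only [w', if_pos h]
          have := M.lb v
          omega) (by
          intro v _ h
          simp only [w', if_neg h]
          omega)
        have h2 : d G p T ≤ d G p X := d_mono (hT.trans (Finset.erase_subset _ _))
        unfold d at h2 hlt
        omega)
  have hno : ∀ v ∈ J, ¬ G.Adj p v := by
    intro v hv h
    have := hJ.lab v hv
    simp only [w', if_pos h] at this
    omega
  have hle : ∀ v, w' v = 5 → w v = 5 := by
    intro v h
    simp only [w'] at h
    split_ifs at h
    · have := M.lb v
      omega
    · exact h
  apply M.bad
  refine ⟨J, hJ.sub.trans (Finset.erase_subset _ _), fun v hv => hle v (hJ.lab v hv), ?_, hJ.ind,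
    ?_, ?_⟩
  · intro q hq hq2
    by_cases h : q = p
    · subst h; exact hno
    · refine hJ.pin q (by simp [h, hq]) ?_
      simp only [w', hq2]
      simp
  · intro t ht u hu v hv htu htv
    by_cases h : t = p
    · subst h; exact absurd htu (hno u hu)
    · exact hJ.ind2 t (by simp [h, ht]) u hu v hv htu htv
  · have : X \ J ⊆ insert p (X.erase p \ J) := by
      intro v hv
      simp only [Finset.mem_insert, Finset.mem_sdiff, Finset.mem_erase] at hv ⊢
      tauto
    refine fr_mono this (fr_insert hJ.frst ?_)
    refine (d_mono ?_).trans (by omega : d G p X ≤ 1)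
    exact Finset.sdiff_subset.trans (Finset.erase_subset _ _)

def addE (G : SimpleGraph V) (y b : V) : SimpleGraph V := G ⊔ SimpleGraph.edge y b

lemma addE_adj {b : V} : (addE G y b).Adj u v ↔
    G.Adj u v ∨ ((u = y ∧ v = b ∨ u = b ∧ v = y) ∧ u ≠ v) := by
  simp [addE, SimpleGraph.sup_adj, SimpleGraph.edge_adj]

lemma s_addE_of_not {b : V} (h : ¬ (y ∈ T ∧ b ∈ T)) : s (addE G y b) T ≤ s G T := by
  apply s_graph
  intro u hu v hv huv
  rcases addE_adj.1 huv with h1 | ⟨⟨rfl, rfl⟩ | ⟨rfl, rfl⟩, -⟩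
  · exact h1
  · exact absurd ⟨hu, hv⟩ h
  · exact absurd ⟨hv, hu⟩ h

lemma s_addE {b : V} : s (addE G y b) T ≤ s G T + 2 := by
  by_cases hy : y ∈ T
  · obtain ⟨T1, hy1, rfl⟩ : ∃ T1, y ∉ T1 ∧ insert y T1 = T :=
      ⟨T.erase y, by simp, Finset.insert_erase hy⟩
    rw [s_insert hy1, s_insert hy1]
    have h1 : s (addE G y b) T1 ≤ s G T1 := s_addE_of_not (by tauto)
    have h2 : d (addE G y b) y T1 ≤ d G y T1 + 1 := by
      unfold d
      refine (Finset.card_le_card ?_).trans (Finset.card_insert_le b _)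
      intro u hu
      simp only [Finset.mem_filter, Finset.mem_insert] at hu ⊢
      rcases addE_adj.1 hu.2 with h1 | ⟨⟨h1, h2⟩ | ⟨h1, h2⟩, h3⟩
      · exact Or.inr ⟨hu.1, h1⟩
      · exact Or.inl h2
      · exact absurd h2.symm h3
    omega
  · have := s_addE_of_not (G := G) (y := y) (b := b) (T := T) (by tauto)
    omega

lemma two_nbrs (h : d G v X = 2) : ∃ a b, a ≠ b ∧ a ∈ X ∧ b ∈ X ∧ G.Adj v a ∧ G.Adj v b ∧
    ∀ u ∈ X, G.Adj v u → u = a ∨ u = b := by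
  obtain ⟨a, b, hab, he⟩ := Finset.card_eq_two.1 h
  have hm : ∀ u, (u ∈ X ∧ G.Adj v u) ↔ (u = a ∨ u = b) := by
    intro u
    rw [← Finset.mem_filter, he]
    simp
  exact ⟨a, b, hab, ((hm a).2 (by simp)).1, ((hm b).2 (by simp)).1, ((hm a).2 (by simp)).2,
    ((hm b).2 (by simp)).2, fun u h1 h2 => (hm u).1 ⟨h1, h2⟩⟩

lemma other_nbr (h : d G v X = 2) {a : V} (ha : a ∈ X) (hva : G.Adj v a) :
    ∃ b, a ≠ b ∧ b ∈ X ∧ G.Adj v b ∧ ∀ u ∈ X, G.Adj v u → u = a ∨ u = b := by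
  obtain ⟨p, q, h1, h2, h3, h4, h5, h6⟩ := two_nbrs h
  rcases h6 a ha hva with rfl | rfl
  · exact ⟨q, h1, h3, h5, h6⟩
  · exact ⟨p, h1.symm, h2, h4, fun u hu hv => (h6 u hu hv).symm⟩

lemma F2 (M : MinC G w X) {f : V} (hf : f ∈ X) (hw : w f = 4) : d G f X ≠ 2 := by
  intro hd
  obtain ⟨a, b, hab, ha, hb, hfa, hfb, hn⟩ := two_nbrs hd
  have hfa' : f ≠ a := hfa.ne
  have hfb' : f ≠ b := hfb.ne
  by_cases hadj : G.Adj a b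
  · -- triangle
    have hp : pot G w {f, a, b} = w a + w b - 8 := by
      rw [pot_insert (by simp [hfa', hfb']), pot_insert (by simp [hab]), pot_single]
      rw [d_insert (by simp [hab])]
      simp [d, Finset.filter_singleton, hfa, hfb, hadj, hw]
      ring
    have hsub : ({f, a, b} : Finset V) ⊆ X := by
      intro v hv
      simp only [Finset.mem_insert, Finset.mem_singleton] at hv
      rcases hv with rfl | rfl | rfl <;> assumption
    have hc : ({f, a, b} : Finset V).card = 3 := by
      rw [Finset.card_insert_of_notMem (by simp [hfa', hfb']), Finset.card_pair hab]
    have hX : ({f, a, b} : Finset V) = X := by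
      by_contra h
      have := gap M hsub h (by omega)
      have := M.lb a
      have := M.lb b
      omega
    have h1 := pot_X M
    rw [← hX, hp] at h1
    -- one of `a`, `b` is unassigned
    have key : ∀ a b : V, a ≠ b → f ≠ a → f ≠ b → ({f, a, b} : Finset V) = X →
        w a = 5 → w b = 4 → False := by
      intro a b hab hfa hfb hX ha5 hb4
      apply M.bad
      refine ⟨{a}, ?_, ?_, ?_, ?_, ?_, ?_⟩
      · rw [← hX]; simp
      · simpa using ha5
      · intro p hp hw2
        rw [← hX] at hp
        simp only [Finset.mem_insert, Finset.mem_singleton] at hp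
        rcases hp with rfl | rfl | rfl <;> omega
      · simp
      · intro t _ u hu v hv _ _
        simp only [Finset.mem_singleton] at hu hv
        rw [hu, hv]
      · have : X \ {a} ⊆ insert f (insert b ∅) := by
          rw [← hX]
          intro v hv
          simp only [Finset.mem_insert, Finset.mem_singleton, Finset.mem_sdiff] at hv ⊢
          tauto
        refine fr_mono this (fr_insert' f b (fr_insert' b b ?_ (by simp)) (by simp))
        intro Z hZ hn
        simp at hZ
        subst hZ
        simp at hn
    rcases M.lab a with h | h | h <;> rcases M.lab b with h' | h' | h' <;> try omega
    · exact key b a hab.symm hfb' hfa' (by rw [← hX]; ext; simp; tauto) h' h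
    · exact key a b hab hfa' hfb' hX h h'
  · have hle : ∀ u v, G.Adj u v → (addE G a b).Adj u v := fun u v h => addE_adj.2 (Or.inl h)
    obtain ⟨J, hJ⟩ := M.ih1 (addE G a b) w (X.erase f) (Finset.card_erase_lt_of_mem hf) M.lab (by
      intro T hT hTn
      have hTX := hT.trans (Finset.erase_subset _ _)
      have hfT : f ∉ T := fun h => by simpa using hT h
      by_cases h : a ∈ T ∧ b ∈ T
      · have h1 := M.ok (insert f T) (Finset.insert_subset hf hTX) ⟨f, by simp⟩
        rw [pot_insert hfT, hw] at h1
        have h2 : 2 ≤ d G f T := by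
          have := d_ge (G := G) (v := f) (T := T) {a, b} (by simp [h.1, h.2, hfa, hfb])
          rwa [Finset.card_pair hab] at this
        have h3 := s_addE (G := G) (y := a) (b := b) (T := T)
        unfold pot at *
        omega
      · have h1 := M.ok T hTX hTn
        have h3 := s_addE_of_not (G := G) h
        unfold pot at *
        omega)
    have hab' : (addE G a b).Adj a b := addE_adj.2 (Or.inr ⟨Or.inl ⟨rfl, rfl⟩, hab⟩)
    have hfJ : f ∉ J := fun h => by simpa using hJ.sub h
    apply M.bad
    refine ⟨J, hJ.sub.trans (Finset.erase_subset _ _), hJ.lab, ?_, ?_, ?_, ?_⟩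
    · intro p hp hp2 v hv h
      exact hJ.pin p (by simp [hp]; rintro rfl; omega) hp2 v hv (hle _ _ h)
    · intro u hu v hv h
      exact hJ.ind u hu v hv (hle _ _ h)
    · intro t ht u hu v hv htu htv
      by_cases h : t = f
      · subst h
        rcases hn u (Finset.mem_of_mem_erase (hJ.sub hu)) htu with rfl | rfl <;>
        rcases hn v (Finset.mem_of_mem_erase (hJ.sub hv)) htv with rfl | rfl
        · rfl
        · exact absurd hab' (hJ.ind _ hu _ hv)
        · exact absurd hab' (hJ.ind _ hv _ hu)
        · rfl
      · exact hJ.ind2 t (by simp [h, ht]) u hu v hv (hle _ _ htu) (hle _ _ htv)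
    · have : X \ J ⊆ insert f (X.erase f \ J) := by
        intro v hv
        simp only [Finset.mem_insert, Finset.mem_sdiff, Finset.mem_erase] at hv ⊢
        tauto
      refine fr_mono this (fr_subdiv hJ.frst (fun u _ v _ => hle u v) hab' hadj ?_)
      intro u hu
      simp only [Finset.mem_sdiff, Finset.mem_erase] at hu
      exact hn u hu.1.2

lemma fr_union_pendant (N : Finset V) (hY : fr G Y)
    (h : ∀ a ∈ N, ∃ o, ∀ u ∈ N ∪ Y, G.Adj a u → u = o) : fr G (N ∪ Y) := by
  induction N using Finset.induction_on with
  | empty => simpa using hY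
  | insert a N ha ih =>
    rw [Finset.insert_union]
    obtain ⟨o, ho⟩ := h a (by simp)
    refine fr_insert' a o (ih ?_) ?_
    · intro a' ha'
      obtain ⟨o', ho'⟩ := h a' (by simp [ha'])
      exact ⟨o', fun u hu => ho' u (by rw [Finset.insert_union]; exact Finset.mem_insert_of_mem hu)⟩
    · intro u hu
      exact ho u (by rw [Finset.insert_union]; exact Finset.mem_insert_of_mem hu)

lemma good_insert {J : Finset V} (hx : x ∈ X) (hw : w x = 5) (hJX : J ⊆ X)
    (hlab : ∀ v ∈ J, w v = 5) (hpin : ∀ p ∈ X, w p = 2 → ∀ v ∈ J, ¬ G.Adj p v)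
    (hpinx : ∀ p ∈ X, w p = 2 → ¬ G.Adj p x) (hind : ∀ u ∈ J, ∀ v ∈ J, ¬ G.Adj u v)
    (hx0 : ∀ v ∈ J, ¬ G.Adj x v)
    (hind2 : ∀ t ∈ X, ∀ u ∈ J, ∀ v ∈ J, G.Adj t u → G.Adj t v → u = v)
    (hx2 : ∀ t ∈ X, G.Adj t x → ∀ v ∈ J, ¬ G.Adj t v) (hf : fr G (X \ insert x J)) :
    ∃ J, Good G w X J := by
  refine ⟨insert x J, Finset.insert_subset hx hJX, ?_, ?_, ?_, ?_, hf⟩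
  · intro v hv
    rcases Finset.mem_insert.1 hv with hv' | hv'
    · rw [hv']; exact hw
    · exact hlab v hv'
  · intro p hp hp2 v hv
    rcases Finset.mem_insert.1 hv with hv' | hv'
    · rw [hv']; exact hpinx p hp hp2
    · exact hpin p hp hp2 v hv'
  · intro u hu v hv
    rcases Finset.mem_insert.1 hu with hu' | hu' <;> rcases Finset.mem_insert.1 hv with hv' | hv'
    · rw [hu', hv']; exact G.loopless.irrefl _
    · rw [hu']; exact hx0 v hv'
    · rw [hv']; exact fun h => hx0 u hu' h.symm
    · exact hind u hu' v hv'
  · intro t ht u hu v hv htu htv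
    rcases Finset.mem_insert.1 hu with hu' | hu' <;> rcases Finset.mem_insert.1 hv with hv' | hv'
    · rw [hu', hv']
    · rw [hu'] at htu; exact absurd htv (hx2 t ht htu v hv')
    · rw [hv'] at htv; exact absurd htu (hx2 t ht htv u hu')
    · exact hind2 t ht u hu' v hv' htu htv

lemma star (M : MinC G w X) (hx : x ∈ X) (hw : w x = 5)
    (hN : ∀ a ∈ X, G.Adj x a → w a = 5 ∧ d G a X = 2) : False := by
  obtain ⟨N, hNdef⟩ : ∃ N, N = X.filter (G.Adj x) := ⟨_, rfl⟩
  have hNm : ∀ a, a ∈ N ↔ a ∈ X ∧ G.Adj x a := fun a => by rw [hNdef]; simp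
  have hxN : x ∉ N := fun h => G.loopless.irrefl _ ((hNm x).1 h).2
  have hoth : ∀ a ∈ N, ∃ o, o ∈ X ∧ x ≠ o ∧ G.Adj a o ∧ ∀ u ∈ X, G.Adj a u → u = x ∨ u = o := by
    intro a ha
    obtain ⟨haX, hxa⟩ := (hNm a).1 ha
    obtain ⟨o, h1, h2, h3, h4⟩ := other_nbr (hN a haX hxa).2 hx hxa.symm
    exact ⟨o, h2, h1, h3, h4⟩
  let Q : V → Prop := fun v => ∃ a ∈ N, G.Adj a v
  let w' : V → ℤ := fun v => if Q v then min (w v) 4 else w v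
  have hlab : Lab w' := by
    intro v
    simp only [w']
    rcases M.lab v with h | h | h <;> rw [h] <;> split_ifs <;> simp
  have hsub : X \ insert x N ⊆ X := Finset.sdiff_subset
  have hxs : x ∉ X \ insert x N := by simp
  have hne : X \ insert x N ≠ X := fun h => hxs (by rw [h]; exact hx)
  obtain ⟨J, hJ⟩ := M.ih1 G w' (X \ insert x N)
    (Finset.card_lt_card (Finset.ssubset_iff_subset_ne.2 ⟨hsub, hne⟩)) hlab (by
      intro T hT hTn
      have hTm : ∀ v ∈ T, v ∈ X ∧ v ≠ x ∧ v ∉ N := fun v hv => by simpa using hT hv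
      have h1 := sum_relabel_le (w := w) (w' := w') (T := T) 1 Q (by
          intro v _ h
          simp only [w', if_pos h]
          have := M.lb v
          omega) (by
          intro v _ h
          simp only [w', if_neg h]
          omega)
      by_cases hc1 : T.card = 1
      · obtain ⟨v, rfl⟩ := Finset.card_eq_one.1 hc1
        rw [pot_single]
        rcases hlab v with h | h | h <;> omega
      · have h3 := gap M (hT.trans hsub) (by rintro rfl; exact hxs (hT hx))
          (by have := hTn.card_pos; omega)
        by_cases hq : (T.filter Q).card ≤ 2
        · exact pot_le_relabel (k := 2) (by omega) h3
        · obtain ⟨NT, hNTdef⟩ : ∃ NT, NT = N.filter (fun a => ∃ t ∈ T, G.Adj a t) := ⟨_, rfl⟩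
          have hNTm : ∀ a, a ∈ NT ↔ a ∈ N ∧ ∃ t ∈ T, G.Adj a t := fun a => by
            rw [hNTdef]; simp
          have hqm : (T.filter Q).card ≤ NT.card := by
            have hss : T.filter Q ⊆ NT.biUnion (fun a => T.filter (G.Adj a)) := by
              intro v hv
              simp only [Finset.mem_filter] at hv
              obtain ⟨a, ha, hav⟩ := hv.2
              simp only [Finset.mem_biUnion, Finset.mem_filter]
              exact ⟨a, (hNTm a).2 ⟨ha, v, hv.1, hav⟩, hv.1, hav⟩
            have := (Finset.card_le_card hss).trans (Finset.card_biUnion_le_card_mul NT _ 1 (by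
              intro a ha
              obtain ⟨o, _, _, _, h4⟩ := hoth a ((hNTm a).1 ha).1
              exact (d_le (G := G) {o} (by
                intro u hu hau
                rcases h4 u (hTm u hu).1 hau with h | h
                · exact absurd h (hTm u hu).2.1
                · simp [h]))))
            omega
          have hdis : Disjoint NT T := Finset.disjoint_left.2 fun v hv hv' =>
            (hTm v hv').2.2 ((hNTm v).1 hv).1
          have hNTX : NT ⊆ X := fun v hv => ((hNm v).1 ((hNTm v).1 hv).1).1
          have hTX : T ⊆ X := hT.trans hsub
          have hx' : x ∉ NT ∪ T := by
            simp only [Finset.mem_union, not_or]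
            exact ⟨fun h => hxN ((hNTm x).1 h).1, fun h => (hTm x h).2.1 rfl⟩
          have h4 := M.ok (insert x (NT ∪ T)) (Finset.insert_subset hx
            (Finset.union_subset hNTX hTX)) ⟨x, by simp⟩
          rw [pot_insert hx', pot_union hdis] at h4
          have h5 : NT.card ≤ d G x (NT ∪ T) := d_ge NT (by
            intro u hu
            exact ⟨by simp [hu], ((hNm u).1 ((hNTm u).1 hu).1).2⟩)
          have h6 : NT.card ≤ c G NT T := by
            have := card_filter_le_c (G := G) (T := NT) (B := T) (fun _ => True)
              (fun v hv _ => ((hNTm v).1 hv).2)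
            simpa using this
          have h7 : pot G w NT ≤ 5 * (NT.card : ℤ) := by
            have : ∑ v ∈ NT, w v ≤ ∑ v ∈ NT, 5 := Finset.sum_le_sum fun v _ => (M.lb v).2
            simp only [Finset.sum_const, nsmul_eq_mul] at this
            unfold pot
            omega
          apply pot_le_relabel (w := w) (k := ((T.filter Q).card : ℤ))
          · omega
          · omega)
  have hJm : ∀ v ∈ J, v ∈ X ∧ v ≠ x ∧ v ∉ N := fun v hv => by simpa using hJ.sub hv
  have hJQ : ∀ v ∈ J, ∀ a ∈ N, ¬ G.Adj a v := by
    intro v hv a ha hav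
    have := hJ.lab v hv
    have hQ : Q v := ⟨a, ha, hav⟩
    rw [show w' v = min (w v) 4 from if_pos hQ] at this
    omega
  apply M.bad
  have hpN : ∀ p ∈ X, w p = 2 → p ≠ x ∧ p ∉ N := by
    intro p hp hp2
    refine ⟨by rintro rfl; omega, fun h => ?_⟩
    have := (hN p hp ((hNm p).1 h).2).1
    omega
  refine good_insert hx hw (fun v hv => (hJm v hv).1) ?_ ?_ ?_ hJ.ind ?_ ?_ ?_ ?_
  · intro v hv
    have h := hJ.lab v hv
    simp only [w'] at h
    split_ifs at h
    · omega
    · exact h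
  · intro p hp hp2 v hv hpv
    have := hpN p hp hp2
    refine hJ.pin p (by simp [hp, this]) ?_ v hv hpv
    simp only [w', hp2]
    simp
  · intro p hp hp2 hpx
    exact (hpN p hp hp2).2 ((hNm p).2 ⟨hp, hpx.symm⟩)
  · exact fun v hv h => (hJm v hv).2.2 ((hNm v).2 ⟨(hJm v hv).1, h⟩)
  · intro t ht u hu v hv htu htv
    by_cases htx : t = x
    · subst htx
      exact absurd ((hNm u).2 ⟨(hJm u hu).1, htu⟩) (hJm u hu).2.2
    · by_cases htN : t ∈ N
      · exact absurd htu (hJQ u hu t htN)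
      · exact hJ.ind2 t (by simp [ht, htx, htN]) u hu v hv htu htv
  · exact fun t ht h1 v hv => hJQ v hv t ((hNm t).2 ⟨ht, h1.symm⟩)
  · have : X \ insert x J ⊆ N ∪ ((X \ insert x N) \ J) := by
      intro v hv
      simp only [Finset.mem_insert, Finset.mem_sdiff, Finset.mem_union] at hv ⊢
      tauto
    refine fr_mono this (fr_union_pendant N hJ.frst ?_)
    intro a ha
    obtain ⟨o, _, _, _, h4⟩ := hoth a ha
    refine ⟨o, fun u hu hau => ?_⟩
    have huX : u ∈ X ∧ u ≠ x := by
      simp only [Finset.mem_insert, Finset.mem_sdiff, Finset.mem_union] at hu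
      rcases hu with hu | hu
      · exact ⟨((hNm u).1 hu).1, by rintro rfl; exact hxN hu⟩
      · tauto
    rcases h4 u huX.1 hau with h | h
    · exact absurd h huX.2
    · exact h

lemma Fthread (M : MinC G w X) {a e : V} (hx : x ∈ X) (hw : w x = 4) (ha : a ∈ X) (hwa : w a = 5)
    (hda : d G a X = 2) (he : e ∈ X) (hwe : w e = 5) (hde : d G e X = 2) (hxa : G.Adj x a)
    (hae : G.Adj a e) : False := by
  have hxe : x ≠ e := by rintro rfl; omega
  have hane : a ≠ e := hae.ne
  have hxna : x ≠ a := hxa.ne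
  obtain ⟨o, ho1, ho2, ho3, ho4⟩ := other_nbr hda hx hxa.symm
  have hoe : e = o := by
    rcases ho4 e he hae with h | h
    · exact absurd h.symm hxe
    · exact h
  subst hoe
  obtain ⟨z, hz1, hz2, hz3, hz4⟩ := other_nbr hde ha hae.symm
  have hze : z ≠ e := hz3.ne'
  have hsub : X \ {a, e} ⊆ X := Finset.sdiff_subset
  have has : a ∉ X \ {a, e} := by simp
  have hne : X \ {a, e} ≠ X := fun h => has (by rw [h]; exact ha)
  have hlab : Lab (Function.update w x 2) := lab_update M.lab (by simp)
  obtain ⟨J, hJ⟩ := M.ih1 G (Function.update w x 2) (X \ {a, e})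
    (Finset.card_lt_card (Finset.ssubset_iff_subset_ne.2 ⟨hsub, hne⟩)) hlab
    (ok_relabel M hsub hne hlab fun T _ => sum_update_le (by omega) (by omega))
  have hJm : ∀ v ∈ J, v ∈ X ∧ v ≠ a ∧ v ≠ e := fun v hv => by simpa using hJ.sub hv
  have hm : ∀ v ∈ X, v ≠ a → v ≠ e → v ∈ X \ {a, e} := fun v h1 h2 h3 => by simp [h1, h2, h3]
  have hxJ : x ∉ J := fun h => by have := hJ.lab x h; simp at this
  have hxno : ∀ v ∈ J, ¬ G.Adj x v := hJ.pin x (hm x hx hxna hxe) (by simp)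
  have hJ5 : ∀ v ∈ J, w v = 5 := by
    intro v hv
    have hvx : v ≠ x := by rintro rfl; exact hxJ hv
    simpa [hvx] using hJ.lab v hv
  have hpin : ∀ p ∈ X, w p = 2 → ∀ v ∈ J, ¬ G.Adj p v := by
    intro p hp hp2
    have hpx : p ≠ x := by rintro rfl; omega
    refine hJ.pin p (hm p hp (by rintro rfl; omega) (by rintro rfl; omega)) ?_
    simpa [hpx] using hp2
  have hind2 : ∀ t ∈ X, ∀ u ∈ J, ∀ v ∈ J, G.Adj t u → G.Adj t v → u = v := by
    intro t ht u hu v hv htu htv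
    by_cases hta : t = a
    · subst hta
      rcases ho4 u (hJm u hu).1 htu with h | h
      · subst h; contradiction
      · exact absurd h (hJm u hu).2.2
    · by_cases hte : t = e
      · subst hte
        rcases hz4 u (hJm u hu).1 htu with h | h
        · exact absurd h (hJm u hu).2.1
        · rcases hz4 v (hJm v hv).1 htv with h' | h'
          · exact absurd h' (hJm v hv).2.1
          · rw [h, h']
      · exact hJ.ind2 t (hm t ht hta hte) u hu v hv htu htv
  apply M.bad
  by_cases hzJ : z ∈ J
  · refine ⟨J, hJ.sub.trans hsub, hJ5, hpin, hJ.ind, hind2, ?_⟩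
    have : X \ J ⊆ insert e (insert a ((X \ {a, e}) \ J)) := by
      intro v hv
      simp only [Finset.mem_insert, Finset.mem_sdiff, Finset.mem_singleton] at hv ⊢
      tauto
    refine fr_mono this (fr_insert' e a (fr_insert' a x hJ.frst ?_) ?_)
    · intro u hu hau
      simp only [Finset.mem_sdiff, Finset.mem_insert, Finset.mem_singleton, not_or] at hu
      rcases ho4 u hu.1.1 hau with h | h
      · exact h
      · exact absurd h hu.1.2.2
    · intro u hu heu
      simp only [Finset.mem_sdiff, Finset.mem_insert, Finset.mem_singleton, not_or] at hu
      rcases hu with h | hu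
      · exact h
      · rcases hz4 u hu.1.1 heu with h | h
        · exact h
        · subst h; exact absurd hzJ hu.2
  · refine good_insert ha hwa (hJ.sub.trans hsub) hJ5 hpin ?_ hJ.ind ?_ hind2 ?_ ?_
    · intro p hp hp2 h
      rcases ho4 p hp h.symm with rfl | rfl <;> omega
    · intro v hv h
      rcases ho4 v (hJm v hv).1 h with rfl | rfl
      · exact hxJ hv
      · exact (hJm _ hv).2.2 rfl
    · intro t ht hta v hv htv
      rcases ho4 t ht hta.symm with rfl | rfl
      · exact hxno v hv htv
      · rcases hz4 v (hJm v hv).1 htv with h | h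
        · exact (hJm v hv).2.1 h
        · subst h; contradiction
    · have : X \ insert a J ⊆ insert e ((X \ {a, e}) \ J) := by
        intro v hv
        simp only [Finset.mem_insert, Finset.mem_sdiff, Finset.mem_singleton] at hv ⊢
        tauto
      refine fr_mono this (fr_insert' e z hJ.frst ?_)
      intro u hu heu
      simp only [Finset.mem_sdiff, Finset.mem_insert, Finset.mem_singleton, not_or] at hu
      rcases hz4 u hu.1.1 heu with h | h
      · exact absurd h hu.1.2.1
      · exact h

lemma sdiff_ne {S : Finset V} {a : V} (ha : a ∈ X) (haS : a ∈ S) : X \ S ≠ X := by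
  intro h
  have : a ∈ X \ S := by rw [h]; exact ha
  simp [haS] at this

lemma sdiff_lt {S : Finset V} {a : V} (ha : a ∈ X) (haS : a ∈ S) : (X \ S).card < X.card :=
  Finset.card_lt_card (Finset.ssubset_iff_subset_ne.2 ⟨Finset.sdiff_subset, sdiff_ne ha haS⟩)

/-- a triangle with two unassigned vertices of degree two -/
lemma tri (M : MinC G w X) {a e q : V} (hx : x ∈ X) (hwx : w x = 5)
    (ha : a ∈ X) (hwa : w a = 5) (he : e ∈ X) (hwe : w e = 5)
    (hq : q ∈ X) (hqa : q ≠ a) (hqe : q ≠ e) (hqx : q ≠ x)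
    (hxa : G.Adj x a) (hae : G.Adj a e)
    (hnx : ∀ u ∈ X, G.Adj x u → u = a ∨ u = e ∨ u = q)
    (hna : ∀ u ∈ X, G.Adj a u → u = x ∨ u = e)
    (hne : ∀ u ∈ X, G.Adj e u → u = x ∨ u = a) : False := by
  have hk : min (w q) 4 = 2 ∨ min (w q) 4 = 4 ∨ min (w q) 4 = 5 := by
    rcases M.lab q with h | h | h <;> rw [h] <;> simp
  have hlab : Lab (Function.update w q (min (w q) 4)) := lab_update M.lab hk
  obtain ⟨J, hJ⟩ := M.ih1 G (Function.update w q (min (w q) 4)) (X \ {x, a, e})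
    (sdiff_lt hx (by simp)) hlab
    (ok_relabel M Finset.sdiff_subset (sdiff_ne hx (by simp)) hlab fun T _ =>
      sum_update_le (by have := M.lb q; omega) (by omega))
  have hJm : ∀ v ∈ J, v ∈ X ∧ v ≠ x ∧ v ≠ a ∧ v ≠ e := fun v hv => by simpa using hJ.sub hv
  have hm : ∀ v ∈ X, v ≠ x → v ≠ a → v ≠ e → v ∈ X \ {x, a, e} := fun v h1 h2 h3 h4 => by
    simp [h1, h2, h3, h4]
  have hqJ : q ∉ J := fun h => by
    have := hJ.lab q h
    simp at this
    omega
  have hxJ : ∀ v ∈ J, ¬ G.Adj x v := by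
    intro v hv h
    obtain ⟨h1, h2, h3, h4⟩ := hJm v hv
    rcases hnx v h1 h with rfl | rfl | rfl <;> contradiction
  have haJ : ∀ v ∈ J, ¬ G.Adj a v := by
    intro v hv h
    obtain ⟨h1, h2, h3, h4⟩ := hJm v hv
    rcases hna v h1 h with rfl | rfl <;> contradiction
  have heJ : ∀ v ∈ J, ¬ G.Adj e v := by
    intro v hv h
    obtain ⟨h1, h2, h3, h4⟩ := hJm v hv
    rcases hne v h1 h with rfl | rfl <;> contradiction
  apply M.bad
  refine good_insert ha hwa (fun v hv => (hJm v hv).1) ?_ ?_ ?_ hJ.ind haJ ?_ ?_ ?_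
  · intro v hv
    have hvq : v ≠ q := by rintro rfl; exact hqJ hv
    simpa [hvq] using hJ.lab v hv
  · intro p hp hp2
    refine hJ.pin p (hm p hp (by rintro rfl; omega) (by rintro rfl; omega)
      (by rintro rfl; omega)) ?_
    by_cases hpq : p = q
    · subst hpq; simp [hp2]
    · simpa [hpq] using hp2
  · intro p hp hp2 h
    rcases hna p hp h.symm with rfl | rfl <;> omega
  · intro t ht u hu v hv htu htv
    by_cases h1 : t = x
    · subst h1; exact absurd htu (hxJ u hu)
    by_cases h2 : t = a
    · subst h2; exact absurd htu (haJ u hu)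
    by_cases h3 : t = e
    · subst h3; exact absurd htu (heJ u hu)
    exact hJ.ind2 t (hm t ht h1 h2 h3) u hu v hv htu htv
  · intro t ht hta
    rcases hna t ht hta.symm with rfl | rfl
    · exact hxJ
    · exact heJ
  · have : X \ insert a J ⊆ insert e (insert x ((X \ {x, a, e}) \ J)) := by
      intro v hv
      simp only [Finset.mem_insert, Finset.mem_sdiff, Finset.mem_singleton] at hv ⊢
      tauto
    refine fr_mono this (fr_insert' e x (fr_insert' x q hJ.frst ?_) ?_)
    · intro u hu h
      simp only [Finset.mem_sdiff, Finset.mem_insert, Finset.mem_singleton, not_or] at hu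
      rcases hnx u hu.1.1 h with h | h | h <;> tauto
    · intro u hu h
      simp only [Finset.mem_sdiff, Finset.mem_insert, Finset.mem_singleton, not_or] at hu
      rcases hu with hu | hu
      · exact hu
      · rcases hne u hu.1.1 h with h | h <;> tauto

/-- `x` with neighbours `a`, `b`, `y`; thread `x a e z`; `b` adjacent to `y` -/
lemma U3adj (M : MinC G w X) {a e b z : V} (hx : x ∈ X) (hwx : w x = 5)
    (ha : a ∈ X) (hwa : w a = 5) (he : e ∈ X) (hwe : w e = 5) (hb : b ∈ X) (hwb : w b = 5)
    (hy : y ∈ X) (hya : y ≠ a) (hye : y ≠ e) (hba : b ≠ a) (hbe : b ≠ e) (hxe : x ≠ e)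
    (hxa : G.Adj x a) (hxb : G.Adj x b) (hxy : G.Adj x y) (hby : G.Adj b y)
    (hnx : ∀ u ∈ X, G.Adj x u → u = a ∨ u = b ∨ u = y)
    (hna : ∀ u ∈ X, G.Adj a u → u = x ∨ u = e)
    (hne : ∀ u ∈ X, G.Adj e u → u = a ∨ u = z)
    (hnb : ∀ u ∈ X, G.Adj b u → u = x ∨ u = y) : False := by
  have hxna := hxa.ne
  have hxnb := hxb.ne
  have hxny := hxy.ne
  have hbny := hby.ne
  have hm : ∀ v ∈ X, v ≠ x → v ≠ a → v ≠ e → v ≠ b → v ∈ X \ {x, a, e, b} :=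
    fun v h1 h2 h3 h4 h5 => by simp [h1, h2, h3, h4, h5]
  have key : ∀ T ⊆ X \ {x, a, e, b}, y ∈ T → 5 ≤ pot G w T := by
    intro T hT hyT
    have hTm : ∀ v ∈ T, v ∈ X ∧ v ≠ x ∧ v ≠ a ∧ v ≠ e ∧ v ≠ b := fun v hv => by
      simpa using hT hv
    have hbT : b ∉ T := fun h => (hTm b h).2.2.2.2 rfl
    have hxT : x ∉ insert b T := by
      simp only [Finset.mem_insert, not_or]
      exact ⟨hxnb, fun h => (hTm x h).2.1 rfl⟩
    have h1 := gap M (S := insert x (insert b T))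
      (Finset.insert_subset hx (Finset.insert_subset hb fun v hv => (hTm v hv).1)) (by
        intro h
        rw [← h] at ha
        simp only [Finset.mem_insert] at ha
        rcases ha with h | h | h
        · exact hxna h.symm
        · exact hba h.symm
        · exact (hTm a h).2.2.1 rfl) (by
        rw [Finset.card_insert_of_notMem hxT, Finset.card_insert_of_notMem hbT]
        omega)
    rw [pot_insert hxT, pot_insert hbT] at h1
    have h2 : 1 ≤ d G b T := by
      simpa using d_ge (G := G) (v := b) (T := T) {y} (by simp [hyT, hby])
    have h3 : 2 ≤ d G x (insert b T) := by
      have := d_ge (G := G) (v := x) (T := insert b T) {b, y} (by simp [hyT, hxb, hxy])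
      rwa [Finset.card_pair hbny] at this
    omega
  have hyY : y ∈ X \ {x, a, e, b} := hm y hy hxny.symm hya hye hbny.symm
  have hwy : w y = 5 := by
    have := key {y} (by simpa using hyY) (by simp)
    rw [pot_single] at this
    have := M.lb y
    omega
  have hlab : Lab (Function.update w y 2) := lab_update M.lab (by simp)
  obtain ⟨J, hJ⟩ := M.ih1 G (Function.update w y 2) (X \ {x, a, e, b})
    (sdiff_lt hx (by simp)) hlab (by
      intro T hT hTn
      by_cases hyT : y ∈ T
      · have := key T hT hyT
        exact pot_le_relabel (k := 3) (w := w) (sum_update_le (by omega) (by omega)) (by omega)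
      · have := M.ok T (hT.trans Finset.sdiff_subset) hTn
        refine pot_le_relabel (k := 0) (w := w) ?_ (by omega)
        rw [Finset.sum_update_of_notMem hyT]
        simp)
  have hJm : ∀ v ∈ J, v ∈ X ∧ v ≠ x ∧ v ≠ a ∧ v ≠ e ∧ v ≠ b := fun v hv => by
    simpa using hJ.sub hv
  have hyJ : y ∉ J := fun h => by
    have := hJ.lab y h
    simp at this
  have hyno : ∀ v ∈ J, ¬ G.Adj y v := hJ.pin y hyY (by simp)
  have hxJ : ∀ v ∈ J, ¬ G.Adj x v := by
    intro v hv h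
    obtain ⟨h1, h2, h3, h4, h5⟩ := hJm v hv
    rcases hnx v h1 h with rfl | rfl | rfl <;> contradiction
  have haJ : ∀ v ∈ J, ¬ G.Adj a v := by
    intro v hv h
    obtain ⟨h1, h2, h3, h4, h5⟩ := hJm v hv
    rcases hna v h1 h with rfl | rfl <;> contradiction
  have hbJ : ∀ v ∈ J, ¬ G.Adj b v := by
    intro v hv h
    obtain ⟨h1, h2, h3, h4, h5⟩ := hJm v hv
    rcases hnb v h1 h with rfl | rfl <;> contradiction
  apply M.bad
  refine good_insert hx hwx (fun v hv => (hJm v hv).1) ?_ ?_ ?_ hJ.ind hxJ ?_ ?_ ?_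
  · intro v hv
    have hvq : v ≠ y := by rintro rfl; exact hyJ hv
    simpa [hvq] using hJ.lab v hv
  · intro p hp hp2
    refine hJ.pin p (hm p hp (by rintro rfl; omega) (by rintro rfl; omega)
      (by rintro rfl; omega) (by rintro rfl; omega)) ?_
    have : p ≠ y := by rintro rfl; omega
    simpa [this] using hp2
  · intro p hp hp2 h
    rcases hnx p hp h.symm with rfl | rfl | rfl <;> omega
  · intro t ht u hu v hv htu htv
    by_cases h1 : t = x
    · subst h1; exact absurd htu (hxJ u hu)
    by_cases h2 : t = a
    · subst h2; exact absurd htu (haJ u hu)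
    by_cases h4 : t = b
    · subst h4; exact absurd htu (hbJ u hu)
    by_cases h3 : t = e
    · subst h3
      rcases hne u (hJm u hu).1 htu with h | h
      · exact absurd h (hJm u hu).2.2.1
      · rcases hne v (hJm v hv).1 htv with h' | h'
        · exact absurd h' (hJm v hv).2.2.1
        · rw [h, h']
    exact hJ.ind2 t (hm t ht h1 h2 h3 h4) u hu v hv htu htv
  · intro t ht hta
    rcases hnx t ht hta.symm with rfl | rfl | rfl
    · exact haJ
    · exact hbJ
    · exact hyno
  · have : X \ insert x J ⊆ insert a (insert e (insert b ((X \ {x, a, e, b}) \ J))) := by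
      intro v hv
      simp only [Finset.mem_insert, Finset.mem_sdiff, Finset.mem_singleton] at hv ⊢
      tauto
    refine fr_mono this (fr_insert' a e (fr_insert' e z (fr_insert' b y hJ.frst ?_) ?_) ?_)
    · intro u hu h
      simp only [Finset.mem_sdiff, Finset.mem_insert, Finset.mem_singleton, not_or] at hu
      rcases hnb u hu.1.1 h with h | h <;> tauto
    · intro u hu h
      simp only [Finset.mem_sdiff, Finset.mem_insert, Finset.mem_singleton, not_or] at hu
      have huX : u ∈ X ∧ u ≠ a := by
        rcases hu with rfl | hu
        · exact ⟨hb, hba⟩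
        · exact ⟨hu.1.1, hu.1.2.2.1⟩
      rcases hne u huX.1 h with h | h
      · exact absurd h huX.2
      · exact h
    · intro u hu h
      simp only [Finset.mem_sdiff, Finset.mem_insert, Finset.mem_singleton, not_or] at hu
      have huX : u ∈ X ∧ u ≠ x := by
        rcases hu with rfl | rfl | hu
        · exact ⟨he, hxe.symm⟩
        · exact ⟨hb, hxnb.symm⟩
        · exact ⟨hu.1.1, hu.1.2.1⟩
      rcases hna u huX.1 h with h | h
      · exact absurd h huX.2
      · exact h

/-- `x` with neighbours `a`, `b`, `y`; thread `x a e z`; `b` not adjacent to `y` -/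
lemma U3nadj (M : MinC G w X) {a e b z o : V} (hx : x ∈ X) (hwx : w x = 5)
    (ha : a ∈ X) (hwa : w a = 5) (he : e ∈ X) (hwe : w e = 5) (hb : b ∈ X) (hwb : w b = 5)
    (hy : y ∈ X) (hya : y ≠ a) (hye : y ≠ e) (hba : b ≠ a) (hbe : b ≠ e) (hxe : x ≠ e)
    (hyb : y ≠ b) (hzx : z ≠ x) (hza : z ≠ a)
    (hxa : G.Adj x a) (hxb : G.Adj x b) (hxy : G.Adj x y) (hby : ¬ G.Adj y b)
    (hbo : G.Adj b o)
    (hnx : ∀ u ∈ X, G.Adj x u → u = a ∨ u = b ∨ u = y)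
    (hna : ∀ u ∈ X, G.Adj a u → u = x ∨ u = e)
    (hne : ∀ u ∈ X, G.Adj e u → u = a ∨ u = z)
    (hnb : ∀ u ∈ X, G.Adj b u → u = x ∨ u = o) : False := by
  have hxna := hxa.ne
  have hxnb := hxb.ne
  have hxny := hxy.ne
  have hm : ∀ v ∈ X, v ≠ x → v ≠ a → v ≠ e → v ∈ X \ {x, a, e} :=
    fun v h1 h2 h3 h4 => by simp [h1, h2, h3, h4]
  have hk : min (w y) 4 = 2 ∨ min (w y) 4 = 4 ∨ min (w y) 4 = 5 := by
    rcases M.lab y with h | h | h <;> rw [h] <;> simp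
  have hlab : Lab (Function.update w y (min (w y) 4)) := lab_update M.lab hk
  have hsum : ∀ T : Finset V, ∑ v ∈ T, w v - ∑ v ∈ T, Function.update w y (min (w y) 4) v ≤ 1 :=
    fun T => sum_update_le (by have := M.lb y; omega) (by omega)
  have hok0 : Ok G (Function.update w y (min (w y) 4)) (X \ {x, a, e}) :=
    ok_relabel M Finset.sdiff_subset (sdiff_ne hx (by simp)) hlab fun T _ =>
      (hsum T).trans (by omega)
  obtain ⟨J, hJ⟩ := M.ih1 (addE G y b) (Function.update w y (min (w y) 4)) (X \ {x, a, e})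
    (sdiff_lt hx (by simp)) hlab (by
      intro T hT hTn
      have hTm : ∀ v ∈ T, v ∈ X ∧ v ≠ x ∧ v ≠ a ∧ v ≠ e := fun v hv => by
        simpa using hT hv
      by_cases h : y ∈ T ∧ b ∈ T
      · have hxT : x ∉ T := fun h => (hTm x h).2.1 rfl
        have h1 := gap M (S := insert x T)
          (Finset.insert_subset hx fun v hv => (hTm v hv).1) (by
            intro h
            rw [← h] at ha
            simp only [Finset.mem_insert] at ha
            rcases ha with h | h
            · exact hxna h.symm
            · exact (hTm a h).2.2.1 rfl) (by
            rw [Finset.card_insert_of_notMem hxT]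
            have := hTn.card_pos
            omega)
        rw [pot_insert hxT] at h1
        have h3 : 2 ≤ d G x T := by
          have := d_ge (G := G) (v := x) (T := T) {y, b} (by simp [h.1, h.2, hxb, hxy])
          rwa [Finset.card_pair hyb] at this
        have h4 := s_addE (G := G) (y := y) (b := b) (T := T)
        have h5 := hsum T
        unfold pot at *
        omega
      · have h1 := hok0 T hT hTn
        have h4 := s_addE_of_not (G := G) h
        unfold pot at *
        omega)
  have hle : ∀ u v, G.Adj u v → (addE G y b).Adj u v := fun u v h => addE_adj.2 (Or.inl h)
  have hyb' : (addE G y b).Adj y b := addE_adj.2 (Or.inr ⟨Or.inl ⟨rfl, rfl⟩, hyb⟩)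
  have hyY := hm y hy hxny.symm hya hye
  have hJm : ∀ v ∈ J, v ∈ X ∧ v ≠ x ∧ v ≠ a ∧ v ≠ e := fun v hv => by
    simpa using hJ.sub hv
  have hyJ : y ∉ J := fun h => by
    have := hJ.lab y h
    simp at this
    omega
  have haJ : ∀ v ∈ J, ¬ G.Adj a v := by
    intro v hv h
    obtain ⟨h1, h2, h3, h4⟩ := hJm v hv
    rcases hna v h1 h with rfl | rfl <;> contradiction
  have hxJ : ∀ v ∈ J, v ≠ b → ¬ G.Adj x v := by
    intro v hv hvb h
    obtain ⟨h1, h2, h3, h4⟩ := hJm v hv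
    rcases hnx v h1 h with rfl | rfl | rfl <;> contradiction
  have hJ5 : ∀ v ∈ J, w v = 5 := by
    intro v hv
    have hvq : v ≠ y := by rintro rfl; exact hyJ hv
    simpa [hvq] using hJ.lab v hv
  have hw2 : ∀ p, w p = 2 → Function.update w y (min (w y) 4) p = 2 := by
    intro p hp2
    by_cases hpq : p = y
    · subst hpq; simp [hp2]
    · simpa [hpq] using hp2
  have hpin : ∀ p ∈ X, w p = 2 → ∀ v ∈ J, ¬ G.Adj p v := by
    intro p hp hp2 v hv h
    exact hJ.pin p (hm p hp (by rintro rfl; omega) (by rintro rfl; omega)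
      (by rintro rfl; omega)) (hw2 p hp2) v hv (hle _ _ h)
  have hind : ∀ u ∈ J, ∀ v ∈ J, ¬ G.Adj u v := fun u hu v hv h =>
    hJ.ind u hu v hv (hle _ _ h)
  have hind2 : ∀ t ∈ X, t ≠ x → ∀ u ∈ J, ∀ v ∈ J, G.Adj t u → G.Adj t v → u = v := by
    intro t ht h1 u hu v hv htu htv
    by_cases h2 : t = a
    · subst h2; exact absurd htu (haJ u hu)
    by_cases h3 : t = e
    · subst h3
      rcases hne u (hJm u hu).1 htu with h | h
      · exact absurd h (hJm u hu).2.2.1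
      · rcases hne v (hJm v hv).1 htv with h' | h'
        · exact absurd h' (hJm v hv).2.2.1
        · rw [h, h']
    exact hJ.ind2 t (hm t ht h1 h2 h3) u hu v hv (hle _ _ htu) (hle _ _ htv)
  have hfr : fr G ((X \ {x, a, e}) \ J) := fr_graph (fun u _ v _ => hle u v) hJ.frst
  apply M.bad
  by_cases hbJ : b ∈ J
  · have hK : ∀ v ∈ J.erase b, v ∈ J ∧ v ≠ b := fun v hv => by
      simp only [Finset.mem_erase] at hv
      exact hv.symm
    refine good_insert (J := J.erase b) hx hwx (fun v hv => (hJm v (hK v hv).1).1)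
      (fun v hv => hJ5 v (hK v hv).1) (fun p hp hp2 v hv => hpin p hp hp2 v (hK v hv).1) ?_
      (fun u hu v hv => hind u (hK u hu).1 v (hK v hv).1)
      (fun v hv => hxJ v (hK v hv).1 (hK v hv).2) ?_ ?_ ?_
    · intro p hp hp2 h
      rcases hnx p hp h.symm with rfl | rfl | rfl
      · omega
      · omega
      · exact hJ.pin p hyY (hw2 p hp2) b hbJ hyb'
    · intro t ht u hu v hv htu htv
      by_cases h1 : t = x
      · subst h1; exact absurd htu (hxJ u (hK u hu).1 (hK u hu).2)
      · exact hind2 t ht h1 u (hK u hu).1 v (hK v hv).1 htu htv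
    · intro t ht htx v hv htv
      rcases hnx t ht htx.symm with rfl | rfl | rfl
      · exact haJ v (hK v hv).1 htv
      · exact hind _ hbJ v (hK v hv).1 htv
      · exact (hK v hv).2 (hJ.ind2 t hyY v (hK v hv).1 b hbJ (hle _ _ htv) hyb')
    · have : X \ insert x (J.erase b) ⊆
          insert a (insert e (insert b ((X \ {x, a, e}) \ J))) := by
        intro v hv
        simp only [Finset.mem_insert, Finset.mem_sdiff, Finset.mem_singleton,
          Finset.mem_erase] at hv ⊢
        tauto
      refine fr_mono this (fr_insert' a e (fr_insert' e z (fr_insert' b o hfr ?_) ?_) ?_)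
      · intro u hu h
        simp only [Finset.mem_sdiff, Finset.mem_insert, Finset.mem_singleton, not_or] at hu
        rcases hnb u hu.1.1 h with h | h <;> tauto
      · intro u hu h
        simp only [Finset.mem_sdiff, Finset.mem_insert, Finset.mem_singleton, not_or] at hu
        have huX : u ∈ X ∧ u ≠ a := by
          rcases hu with rfl | hu
          · exact ⟨hb, hba⟩
          · exact ⟨hu.1.1, hu.1.2.2.1⟩
        rcases hne u huX.1 h with h | h
        · exact absurd h huX.2
        · exact h
      · intro u hu h
        simp only [Finset.mem_sdiff, Finset.mem_insert, Finset.mem_singleton, not_or] at hu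
        have huX : u ∈ X ∧ u ≠ x := by
          rcases hu with rfl | rfl | hu
          · exact ⟨he, hxe.symm⟩
          · exact ⟨hb, hxnb.symm⟩
          · exact ⟨hu.1.1, hu.1.2.1⟩
        rcases hna u huX.1 h with h | h
        · exact absurd h huX.2
        · exact h
  · have hxJ' : ∀ v ∈ J, ¬ G.Adj x v := fun v hv => hxJ v hv (by rintro rfl; exact hbJ hv)
    have hind2' : ∀ t ∈ X, ∀ u ∈ J, ∀ v ∈ J, G.Adj t u → G.Adj t v → u = v := by
      intro t ht u hu v hv htu htv
      by_cases h1 : t = x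
      · subst h1; exact absurd htu (hxJ' u hu)
      · exact hind2 t ht h1 u hu v hv htu htv
    have hfx : fr G (insert x ((X \ {x, a, e}) \ J)) := by
      refine fr_subdiv hJ.frst (fun u _ v _ => hle u v) hyb' hby ?_
      intro u hu h
      simp only [Finset.mem_sdiff, Finset.mem_insert, Finset.mem_singleton, not_or] at hu
      rcases hnx u hu.1.1 h with h | h | h <;> tauto
    by_cases hzJ : z ∈ J
    · refine ⟨J, fun v hv => (hJm v hv).1, hJ5, hpin, hind, hind2', ?_⟩
      have : X \ J ⊆ insert e (insert a (insert x ((X \ {x, a, e}) \ J))) := by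
        intro v hv
        simp only [Finset.mem_insert, Finset.mem_sdiff, Finset.mem_singleton] at hv ⊢
        tauto
      refine fr_mono this (fr_insert' e a (fr_insert' a x hfx ?_) ?_)
      · intro u hu h
        simp only [Finset.mem_sdiff, Finset.mem_insert, Finset.mem_singleton, not_or] at hu
        rcases hu with hu | hu
        · exact hu
        · rcases hna u hu.1.1 h with h | h <;> tauto
      · intro u hu h
        simp only [Finset.mem_sdiff, Finset.mem_insert, Finset.mem_singleton, not_or] at hu
        rcases hu with hu | hu | hu
        · exact hu
        · subst hu
          rcases hne u hx h with h | h
          · exact h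
          · exact absurd h.symm hzx
        · rcases hne u hu.1.1 h with h | h
          · exact h
          · subst h; exact absurd hzJ hu.2
    · refine good_insert ha hwa (fun v hv => (hJm v hv).1) hJ5 hpin ?_ hind haJ hind2' ?_ ?_
      · intro p hp hp2 h
        rcases hna p hp h.symm with rfl | rfl <;> omega
      · intro t ht hta v hv htv
        rcases hna t ht hta.symm with rfl | rfl
        · exact hxJ' v hv htv
        · rcases hne v (hJm v hv).1 htv with h | h
          · exact (hJm v hv).2.2.1 h
          · subst h; contradiction
      · have : X \ insert a J ⊆ insert e (insert x ((X \ {x, a, e}) \ J)) := by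
          intro v hv
          simp only [Finset.mem_insert, Finset.mem_sdiff, Finset.mem_singleton] at hv ⊢
          tauto
        refine fr_mono this (fr_insert' e z hfx ?_)
        intro u hu h
        simp only [Finset.mem_sdiff, Finset.mem_insert, Finset.mem_singleton, not_or] at hu
        have huX : u ∈ X ∧ u ≠ a := by
          rcases hu with rfl | hu
          · exact ⟨hx, hxna⟩
          · exact ⟨hu.1.1, hu.1.2.2.1⟩
        rcases hne u huX.1 h with h | h
        · exact absurd h huX.2
        · exact h

lemma U3 (M : MinC G w X) {a e b : V} (hx : x ∈ X) (hwx : w x = 5) (hdx : d G x X = 3)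
    (ha : a ∈ X) (hwa : w a = 5) (hda : d G a X = 2)
    (he : e ∈ X) (hwe : w e = 5) (hde : d G e X = 2)
    (hb : b ∈ X) (hwb : w b = 5) (hdb : d G b X = 2)
    (hxa : G.Adj x a) (hae : G.Adj a e) (hxb : G.Adj x b) (hba : b ≠ a) : False := by
  have hxe : x ≠ e := by rintro rfl; omega
  obtain ⟨y, hyeq⟩ : ∃ y, ((X.filter (G.Adj x)).erase a).erase b = {y} := by
    apply Finset.card_eq_one.1
    rw [Finset.card_erase_of_mem (by simp [hba, hb, hxb]),
      Finset.card_erase_of_mem (by simp [ha, hxa])]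
    unfold d at hdx
    omega
  have hym : ∀ u, (u ≠ b ∧ u ≠ a ∧ u ∈ X ∧ G.Adj x u) ↔ u = y := by
    intro u
    have : u ∈ ((X.filter (G.Adj x)).erase a).erase b ↔ u ∈ ({y} : Finset V) := by rw [hyeq]
    simpa using this
  obtain ⟨hyb, hya, hy, hxy⟩ := (hym y).2 rfl
  have hnx : ∀ u ∈ X, G.Adj x u → u = a ∨ u = b ∨ u = y := by
    intro u hu h
    by_cases h1 : u = a
    · exact Or.inl h1
    by_cases h2 : u = b
    · exact Or.inr (Or.inl h2)
    exact Or.inr (Or.inr ((hym u).1 ⟨h2, h1, hu, h⟩))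
  obtain ⟨e', _, _, _, hna⟩ := other_nbr hda hx hxa.symm
  have hee : e = e' := (hna e he hae).resolve_left hxe.symm
  subst hee
  obtain ⟨z, hz1, hzX, hez, hne⟩ := other_nbr hde ha hae.symm
  by_cases hzx : z = x
  · subst hzx
    rcases hnx e he hez.symm with h | h | h
    · exact absurd h hae.ne'
    · subst h
      exact tri M (a := a) (e := e) (q := y) hx hwx ha hwa he hwe hy hya hyb hxy.ne' hxa hae hnx hna
        (fun u hu h => (hne u hu h).symm)
    · subst h
      exact tri M (a := a) (e := e) (q := b) hx hwx ha hwa he hwe hb hba hyb.symm hxb.ne' hxa hae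
        (fun u hu h => by rcases hnx u hu h with h | h | h <;> tauto) hna
        (fun u hu h => (hne u hu h).symm)
  · have hex : ¬ G.Adj x e := by
      intro h
      rcases hne x hx h.symm with h | h
      · exact hxa.ne h
      · exact hzx h.symm
    have hye : y ≠ e := by rintro rfl; exact hex hxy
    have hbe : b ≠ e := by rintro rfl; exact hex hxb
    obtain ⟨o, ho1, hoX, hbo, hnb⟩ := other_nbr hdb hx hxb.symm
    by_cases hby : G.Adj b y
    · have hoy : y = o := (hnb y hy hby).resolve_left hxy.ne'
      subst hoy
      exact U3adj M hx hwx ha hwa he hwe hb hwb hy hya hye hba hbe hxe hxa hxb hxy hby hnx hna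
        hne hnb
    · exact U3nadj M hx hwx ha hwa he hwe hb hwb hy hya hye hba hbe hxe hyb hzx hz1.symm hxa hxb
        hxy (fun h => hby h.symm) hbo hnx hna hne hnb

lemma MinC.false (M : MinC G w X) : False := by
  let U2 : V → Prop := fun v => v ∈ X ∧ w v = 5 ∧ d G v X = 2
  let hv2 : V → Prop := fun v => ∃ e, U2 e ∧ G.Adj v e
  let t : V → V → ℤ := fun x a =>
    if ¬ U2 x ∧ U2 a ∧ G.Adj x a then (if hv2 a then 2 else 1) else 0
  have ht0 : ∀ x a, 0 ≤ t x a := by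
    intro x a
    simp only [t]
    split_ifs <;> omega
  -- outgoing charge
  let N : V → Finset V := fun v => X.filter fun a => U2 a ∧ G.Adj v a
  have hNm : ∀ v a, a ∈ N v ↔ a ∈ X ∧ U2 a ∧ G.Adj v a := fun v a => by simp [N]
  have hNd : ∀ v, (N v).card ≤ d G v X := by
    intro v
    apply Finset.card_le_card
    intro a ha
    have := (hNm v a).1 ha
    simp [this.1, this.2.2]
  have hout : ∀ v (k : ℤ), (∀ a ∈ X, U2 a → G.Adj v a → t v a ≤ k) →
      ∑ a ∈ X, t v a ≤ k * ((N v).card : ℤ) := by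
    intro v k h
    simp only [N]
    rw [Finset.card_filter]
    push_cast
    rw [Finset.mul_sum]
    apply Finset.sum_le_sum
    intro a ha
    by_cases hc : U2 a ∧ G.Adj v a
    · simpa [hc] using h a ha hc.1 hc.2
    · have : t v a = 0 := by
        simp only [t]
        rw [if_neg (by tauto)]
      simp [hc, this]
  have ht2 : ∀ x a, t x a ≤ 2 := by
    intro x a
    simp only [t]
    split_ifs <;> omega
  have hout2 : ∀ v, ∑ a ∈ X, t v a ≤ 2 * ((N v).card : ℤ) := fun v =>
    hout v 2 fun a _ _ _ => ht2 v a
  have ht1 : ∀ x a, ¬ hv2 a → t x a ≤ 1 := by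
    intro x a h
    simp only [t, if_neg h]
    split_ifs <;> omega
  have hstar : ∀ v ∈ X, w v = 5 → (N v).card < d G v X := by
    intro v hv hw
    by_contra hge
    apply star M hv hw
    intro a ha hva
    have heq : N v = X.filter (G.Adj v) := by
      apply Finset.eq_of_subset_of_card_le
      · intro a ha
        have := (hNm v a).1 ha
        simp [this.1, this.2.2]
      · unfold d at hge
        omega
    have hm : a ∈ N v := by rw [heq]; simp [ha, hva]
    exact ((hNm v a).1 hm).2.1.2
  have hfin : ∀ v ∈ X, 0 ≤ 4 * (d G v X : ℤ) - 2 * w v - ∑ a ∈ X, t v a + ∑ x ∈ X, t x v := by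
    intro v hv
    by_cases hU : U2 v
    · have h1 : ∑ a ∈ X, t v a = 0 := Finset.sum_eq_zero fun a _ => by
        simp only [t]
        rw [if_neg (by tauto)]
      obtain ⟨p, q, hpq, hp, hq, hvp, hvq, hn⟩ := two_nbrs hU.2.2
      have h2 : t p v + t q v ≤ ∑ x ∈ X, t x v := by
        rw [← Finset.sum_pair (f := fun x => t x v) hpq]
        apply Finset.sum_le_sum_of_subset_of_nonneg
        · intro x hx
          simp only [Finset.mem_insert, Finset.mem_singleton] at hx
          rcases hx with rfl | rfl <;> assumption
        · intro x _ _
          exact ht0 x v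
      have h3 : ¬ (U2 p ∧ U2 q) := by
        rintro ⟨h3, h4⟩
        apply star M hv hU.2.1
        intro a ha hva
        rcases hn a ha hva with rfl | rfl
        · exact h3.2
        · exact h4.2
      have h4 : 2 ≤ t p v + t q v := by
        by_cases hh : hv2 v
        · by_cases hp2 : U2 p
          · have hq2 : ¬ U2 q := by tauto
            have : t q v = 2 := by
              simp only [t]
              rw [if_pos ⟨hq2, hU, hvq.symm⟩, if_pos hh]
            have := ht0 p v
            omega
          · have : t p v = 2 := by
              simp only [t]
              rw [if_pos ⟨hp2, hU, hvp.symm⟩, if_pos hh]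
            have := ht0 q v
            omega
        · have hp2 : ¬ U2 p := fun h => hh ⟨p, h, hvp⟩
          have hq2 : ¬ U2 q := fun h => hh ⟨q, h, hvq⟩
          have e1 : t p v = 1 := by
            simp only [t]
            rw [if_pos ⟨hp2, hU, hvp.symm⟩, if_neg hh]
          have e2 : t q v = 1 := by
            simp only [t]
            rw [if_pos ⟨hq2, hU, hvq.symm⟩, if_neg hh]
          omega
      have h5 := hU.2.1
      have h6 := hU.2.2
      omega
    · have hin : 0 ≤ ∑ x ∈ X, t x v := Finset.sum_nonneg fun x _ => ht0 x v
      have ho := hout2 v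
      have hnd := hNd v
      rcases M.lab v with hw | hw | hw
      · have := pin_deg M hv hw
        omega
      · have h1 := low_deg M hv (by omega)
        have h2 := F2 M hv hw
        have h3 := hout v 1 (by
          intro a ha hUa hva
          apply ht1
          rintro ⟨e, he, hae⟩
          exact Fthread M hv hw ha hUa.2.1 hUa.2.2 he.1 he.2.1 he.2.2 hva hae)
        omega
      · have h1 := low_deg M hv (by omega)
        have h2 : d G v X ≠ 2 := fun h => hU ⟨hv, hw, h⟩
        have h3 := hstar v hv hw
        by_cases h4 : d G v X = 3
        · by_cases hh : ∃ a ∈ N v, hv2 a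
          · obtain ⟨a, ha, e, he, hae⟩ := hh
            obtain ⟨haX, hUa, hva⟩ := (hNm v a).1 ha
            have : (N v).card ≤ 1 := by
              refine (Finset.card_le_card (t := {a}) fun b hb => ?_).trans (by simp)
              rw [Finset.mem_singleton]
              by_contra hba
              obtain ⟨hbX, hUb, hvb⟩ := (hNm v b).1 hb
              exact U3 M hv hw h4 haX hUa.2.1 hUa.2.2 he.1 he.2.1 he.2.2 hbX hUb.2.1 hUb.2.2
                hva hae hvb hba
            omega
          · have h5 := hout v 1 (by
              intro a ha hUa hva
              apply ht1
              exact fun h => hh ⟨a, (hNm v a).2 ⟨ha, hUa, hva⟩, h⟩)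
            omega
        · omega
  have htot := Finset.sum_nonneg hfin
  rw [Finset.sum_add_distrib, Finset.sum_sub_distrib, Finset.sum_sub_distrib,
    Finset.sum_comm (f := fun v x => t x v), ← Finset.mul_sum, ← Finset.mul_sum] at htot
  have hp := pot_X M
  unfold pot s at hp
  push_cast at hp
  omega

theorem main_pot (G : SimpleGraph V) (w : V → ℤ) (X : Finset V) (hl : Lab w) (hok : Ok G w X) :
    ∃ J, Good G w X J := by
  have : ∀ (n m : ℕ) (G : SimpleGraph V) (w : V → ℤ) (X : Finset V), X.card = n →
      (X.filter (fun v => w v = 5)).card = m → Lab w → Ok G w X → ∃ J, Good G w X J := by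
    intro n
    induction n using Nat.strong_induction_on with
    | _ n ihn =>
      intro m
      induction m using Nat.strong_induction_on with
      | _ m ihm =>
        intro G w X hn hm hl hok
        by_contra hbad
        exact MinC.false (G := G) (w := w) (X := X) ⟨hl, hok, hbad,
          fun G' w' X' hc hl' hok' => ihn _ (by omega) _ G' w' X' rfl rfl hl' hok',
          fun w' hc hl' hok' => ihm _ (by omega) G w' X hn rfl hl' hok'⟩
  exact this _ _ G w X rfl rfl hl hok

lemma two_card_edges [Fintype V] (G : SimpleGraph V) (S : Finset V) :
    2 * Nat.card ((⊤ : G.Subgraph).induce (S : Set V)).edgeSet = s G S := by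
  obtain ⟨K, hK⟩ : ∃ K : SimpleGraph V, K = ((⊤ : G.Subgraph).induce (S : Set V)).spanningCoe :=
    ⟨_, rfl⟩
  have hadj : ∀ u v, K.Adj u v ↔ u ∈ S ∧ v ∈ S ∧ G.Adj u v := by
    intro u v
    rw [hK]
    simp
  have he : K.edgeSet = ((⊤ : G.Subgraph).induce (S : Set V)).edgeSet := by
    rw [hK]
    rfl
  rw [← he, Nat.card_eq_fintype_card, ← SimpleGraph.edgeFinset_card,
    ← K.sum_degrees_eq_twice_card_edges]
  have : ∀ v, K.degree v = if v ∈ S then d G v S else 0 := by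
    intro v
    rw [← SimpleGraph.card_neighborFinset_eq_degree]
    split_ifs with h
    · unfold d
      congr 1
      ext u
      simp [hadj, h]
    · rw [Finset.card_eq_zero]
      ext u
      simp [hadj, h]
  simp only [this]
  rw [Finset.sum_ite_mem]
  simp [s]

lemma rho_eq [Fintype V] (G : SimpleGraph V) (I F U : Set V) (hA : IsAssignment I F U)
    (S : Finset V) : rho G I F U ((⊤ : G.Subgraph).induce (S : Set V)) =
      pot G (fun v => if v ∈ I then 1 else if v ∈ F then 4 else 5) S := by
  obtain ⟨h1, h2, h3, h4⟩ := hA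
  have hn : ∀ R : Set V, (((S : Set V) ∩ R).ncard : ℤ) = ∑ v ∈ S, if v ∈ R then 1 else 0 := by
    intro R
    have : ((S : Set V) ∩ R) = ((S.filter (· ∈ R) : Finset V) : Set V) := by
      ext v
      simp
    rw [this, Set.ncard_coe_finset, Finset.card_filter]
    push_cast
    rfl
  unfold rho pot
  rw [SimpleGraph.Subgraph.induce_verts, hn, hn, hn, ← two_card_edges, Finset.mul_sum,
    Finset.mul_sum, ← Finset.sum_add_distrib, ← Finset.sum_add_distrib]
  push_cast
  have : ∀ v ∈ S, ((if v ∈ I then (1 : ℤ) else 0) + 4 * (if v ∈ F then 1 else 0)) +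
      5 * (if v ∈ U then 1 else 0) = if v ∈ I then 1 else if v ∈ F then 4 else 5 := by
    intro v _
    have hv : v ∈ I ∪ F ∪ U := by rw [h1]; trivial
    by_cases hI : v ∈ I
    · have hF : v ∉ F := fun h => Set.disjoint_left.1 h2 hI h
      have hU : v ∉ U := fun h => Set.disjoint_left.1 h3 hI h
      simp [hI, hF, hU]
    · by_cases hF : v ∈ F
      · have hU : v ∉ U := fun h => Set.disjoint_left.1 h4 hF h
        simp [hI, hF, hU]
      · have hU : v ∈ U := by
          rcases hv with (h | h) | h
          · contradiction
          · contradiction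
          · exact h
        simp [hI, hF, hU]
  rw [Finset.sum_congr rfl this]
  ring

lemma acyclic_of_fr [Fintype V] {B : Set V} (hB : ∀ v ∈ B, v ∈ Y) (hf : fr G Y) :
    (G.induce B).IsAcyclic := by
  intro v p hp
  obtain ⟨Z, hZ⟩ : ∃ Z : Finset V, Z = p.support.toFinset.image Subtype.val := ⟨_, rfl⟩
  have hmem : ∀ u (hu : u ∈ B), (⟨u, hu⟩ : B) ∈ p.support → u ∈ Z := by
    intro u hu h
    rw [hZ, Finset.mem_image]
    exact ⟨⟨u, hu⟩, by simpa using h, rfl⟩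
  have hZY : Z ⊆ Y := by
    intro z hz
    rw [hZ, Finset.mem_image] at hz
    obtain ⟨u, _, rfl⟩ := hz
    exact hB _ u.2
  have h1 := hf Z hZY ⟨v.1, hmem v.1 v.2 p.start_mem_support⟩
  have h2 : ∀ z ∈ Z, 2 ≤ d G z Z := by
    intro z hz
    rw [hZ, Finset.mem_image] at hz
    obtain ⟨u, hu, rfl⟩ := hz
    have h3 := hp.ncard_neighborSet_toSubgraph_eq_two (by simpa using hu)
    obtain ⟨a, b, hab, he⟩ := Set.ncard_eq_two.1 h3
    have hm : ∀ q : B, q = a ∨ q = b → q.1 ∈ Z ∧ G.Adj u.1 q.1 := by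
      intro q hq
      have hq' : q ∈ p.toSubgraph.neighborSet u := by
        rw [he]
        simpa using hq
      have hq2 : p.toSubgraph.Adj u q := hq'
      have hq3 : q ∈ p.toSubgraph.verts := hq2.symm.fst_mem
      refine ⟨hmem q.1 q.2 ((SimpleGraph.Walk.mem_verts_toSubgraph p).1 hq3), ?_⟩
      exact hq2.adj_sub
    have h4 := d_ge (G := G) (v := u.1) (T := Z) {a.1, b.1} (by
      intro q hq
      simp only [Finset.mem_insert, Finset.mem_singleton] at hq
      rcases hq with rfl | rfl
      · exact hm a (Or.inl rfl)
      · exact hm b (Or.inr rfl))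
    rwa [Finset.card_pair (fun h => hab (Subtype.ext h))] at h4
  have h3 := Finset.sum_le_sum h2
  simp only [Finset.sum_const, smul_eq_mul] at h3
  unfold s at h1
  omega

theorem no_cex [Fintype V] (G : SimpleGraph V) (I F U : Set V) : ¬ IsCounterexample G I F U := by
  rintro ⟨hA, hpos, hbad⟩
  let w0 : V → ℤ := fun v => if v ∈ I then 1 else if v ∈ F then 4 else 5
  have hw0 : ∀ v, 1 ≤ w0 v ∧ w0 v ≤ 5 := by
    intro v
    simp only [w0]
    split_ifs <;> omega
  have hwI : ∀ v ∈ I, w0 v = 1 := fun v hv => by simp [w0, hv]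
  have hp : ∀ S : Finset V, S.Nonempty → 1 ≤ pot G w0 S := by
    intro S hS
    have := hpos ((⊤ : G.Subgraph).induce (S : Set V)) (by simpa using hS)
    rw [rho_eq G I F U hA S] at this
    exact this
  let X : Finset V := Finset.univ.filter (· ∉ I)
  have hX : ∀ v, v ∈ X ↔ v ∉ I := by simp [X]
  let Q : V → Prop := fun v => ∃ i ∈ I, G.Adj v i
  let w : V → ℤ := fun v => if Q v then 2 else if v ∈ F then 4 else 5
  have hl : Lab w := by
    intro v
    simp only [w]
    split_ifs <;> simp
  obtain ⟨J, hJ⟩ := main_pot G w X hl (by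
    intro T hT hTn
    obtain ⟨N, hN⟩ : ∃ N : Finset V, N = Finset.univ.filter (fun i => i ∈ I ∧ ∃ t ∈ T, G.Adj i t) :=
      ⟨_, rfl⟩
    have hNm : ∀ i, i ∈ N ↔ i ∈ I ∧ ∃ t ∈ T, G.Adj i t := fun i => by rw [hN]; simp
    have hdis : Disjoint T N := Finset.disjoint_left.2 fun v hv hv' =>
      (hX v).1 (hT hv) ((hNm v).1 hv').1
    have h1 := hp (T ∪ N) (hTn.mono Finset.subset_union_left)
    rw [pot_union hdis] at h1
    have h2 : pot G w0 N ≤ (N.card : ℤ) := by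
      have : ∑ v ∈ N, w0 v = ∑ v ∈ N, 1 :=
        Finset.sum_congr rfl fun v hv => hwI v ((hNm v).1 hv).1
      simp only [Finset.sum_const, nsmul_eq_mul] at this
      unfold pot
      omega
    have h3 : N.card ≤ c G T N := by
      rw [c_comm]
      have := card_filter_le_c (G := G) (T := N) (B := T) (fun _ => True)
        (fun v hv _ => ((hNm v).1 hv).2)
      simpa using this
    have h4 : (T.filter Q).card ≤ c G T N := card_filter_le_c Q (by
      rintro v hv ⟨i, hi, hvi⟩
      exact ⟨i, (hNm i).2 ⟨hi, v, hv, hvi.symm⟩, hvi⟩)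
    have h5 := sum_relabel_le (w := w0) (w' := w) (T := T) 3 Q (by
      intro v _ h
      have := hw0 v
      simp only [w, if_pos h]
      omega) (by
      intro v hv h
      have hvI := (hX v).1 (hT hv)
      simp only [w, if_neg h, w0, if_neg hvI]
      omega)
    apply pot_le_relabel h5
    omega)
  have hI1 : ∀ u ∈ I, ∀ v ∈ I, ¬ G.Adj u v := by
    intro u hu v hv h
    have := hp {u, v} ⟨u, by simp⟩
    rw [pot_insert (by simpa using h.ne), pot_single, hwI u hu, hwI v hv] at this
    have h2 : 1 ≤ d G u {v} := by
      simpa using d_ge (G := G) (v := u) (T := {v}) {v} (by simp [h])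
    omega
  have hI2 : ∀ u ∈ I, ∀ v ∈ I, u ≠ v → ∀ t, ¬ (G.Adj u t ∧ G.Adj t v) := by
    rintro u hu v hv huv t ⟨h1, h2⟩
    have := hp {t, u, v} ⟨t, by simp⟩
    rw [pot_insert (by simp [h1.ne', h2.ne]), pot_insert (by simpa using huv), pot_single,
      hwI u hu, hwI v hv] at this
    have h3 : 2 ≤ d G t {u, v} := by
      have := d_ge (G := G) (v := t) (T := {u, v}) {u, v} (by simp [h1.symm, h2])
      rwa [Finset.card_pair huv] at this
    have := hw0 t
    omega
  have hJQ : ∀ v ∈ J, ¬ Q v ∧ v ∉ F := by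
    intro v hv
    have := hJ.lab v hv
    simp only [w] at this
    constructor
    · intro h
      rw [if_pos h] at this
      omega
    · intro h
      rw [if_pos h] at this
      split_ifs at this <;> omega
  have hIJ : ∀ u ∈ I, ∀ v ∈ J, ∀ t, ¬ (G.Adj t u ∧ G.Adj t v) := by
    rintro u hu v hv t ⟨h1, h2⟩
    have ht : t ∈ X := (hX t).2 fun h => hI1 t h u hu h1
    have hQ : Q t := ⟨u, hu, h1⟩
    exact hJ.pin t ht (by simp only [w, if_pos hQ]) v hv h2
  have hdF := hA.2.1
  refine hbad ⟨I ∪ (J : Set V), (I ∪ (J : Set V))ᶜ, ⟨Set.union_compl_self _, disjoint_compl_right,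
    ?_, ?_⟩, Set.subset_union_left, ?_⟩
  · intro u hu v hv huv
    rcases hu with hu | hu <;> rcases hv with hv | hv
    · exact ⟨hI1 u hu v hv, hI2 u hu v hv huv⟩
    · refine ⟨fun h => (hJQ v hv).1 ⟨u, hu, h.symm⟩, fun t h => ?_⟩
      exact hIJ u hu v hv t ⟨h.1.symm, h.2⟩
    · refine ⟨fun h => (hJQ u hu).1 ⟨v, hv, h⟩, fun t h => ?_⟩
      exact hIJ v hv u hu t ⟨h.2, h.1.symm⟩
    · refine ⟨hJ.ind u hu v hv, fun t h => ?_⟩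
      have ht : t ∈ X := (hX t).2 fun h' => (hJQ u hu).1 ⟨t, h', h.1⟩
      exact huv (hJ.ind2 t ht u hu v hv h.1.symm h.2)
  · apply acyclic_of_fr (Y := X \ J) _ hJ.frst
    intro v hv
    simp only [Set.mem_compl_iff, Set.mem_union, Finset.mem_coe, not_or] at hv
    simp [hX, hv.1, hv.2]
  · intro v hv
    simp only [Set.mem_compl_iff, Set.mem_union, Finset.mem_coe, not_or]
    exact ⟨fun h => Set.disjoint_left.1 hdF h hv, fun h => (hJQ v h).2 hv⟩

end IFP

/-- In a minimal counterexample, an induced proper subgraph `H = G[S]` with `ρ(H) < 3` and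
`|V(H)| + |E(H)| ≤ 4` is one of five assigned graphs: a single vertex in `I`; two nonadjacent
vertices in `I`; an edge from `I` to `U`; an edge from `I` to `F`; or an edge from `I` to `F`
together with an isolated additional vertex in `I`. -/
theorem small_low_potential_classification {V : Type*} [Fintype V] (G : SimpleGraph V)
    (I F U : Set V) (hmin : IsMinCounterexample G I F U)
    (S : Set V) (hproper : S ≠ Set.univ)
    (hpot : rhoSet G I F U S < 3)
    (hsize : S.ncard + edgeCount (G.induce S) ≤ 4) :
    (∃ v, S = {v} ∧ v ∈ I) ∨
    (∃ u v, u ≠ v ∧ S = {u, v} ∧ u ∈ I ∧ v ∈ I ∧ ¬ G.Adj u v) ∨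
    (∃ u v, S = {u, v} ∧ u ∈ I ∧ v ∈ U ∧ G.Adj u v) ∨
    (∃ u v, S = {u, v} ∧ u ∈ I ∧ v ∈ F ∧ G.Adj u v) ∨
    (∃ u v w, u ≠ w ∧ v ≠ w ∧ S = {u, v, w} ∧ u ∈ I ∧ v ∈ F ∧ w ∈ I ∧
      G.Adj u v ∧ ¬ G.Adj u w ∧ ¬ G.Adj v w) := by
  exact absurd hmin.1 (IFP.no_cex G I F U)
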